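/- Serfaty's inequality (Coulomb case, d = 3): there exists a constant C > 2 such that for every integer N ≥ 2, every bounded measurable probability density ρ on ℝ³, every bounded Lipschitz vector field u : ℝ³ → ℝ³, and every X_N = (x₁,…,x_N) ∈ (ℝ³)^N with pairwise distinct components, one has |F'_N(X_N,(ρ,u))| ≤ C ‖∇u‖_{L^∞(ℝ³)} F_N(X_N,ρ) + C (1 + ‖ρ‖_{L^∞(ℝ³)}) (1 + ‖u‖_{W^{1,∞}(ℝ³)}) N^{5/3}, where ‖∇u‖_{L^∞} denotes the Lipschitz constant of u and ‖u‖_{W^{1,∞}} := ‖u‖_{L^∞} + ‖∇u‖_{L^∞}. -/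

import Mathlib

open MeasureTheory Real
open scoped ENNReal NNReal

noncomputable section

abbrev E3 : Type := EuclideanSpace ℝ (Fin 3)

/-- The repulsive Coulomb potential `V(z) = 1/(4π|z|)` on `ℝ³`. -/
def V (z : E3) : ℝ := (4 * π * ‖z‖)⁻¹

/-- The empirical measure `μ_{X_N} = (1/N) ∑ δ_{x_j}`. -/
def empMeas {N : ℕ} (X : Fin N → E3) : Measure E3 :=
  (N : ℝ≥0∞)⁻¹ • ∑ j, Measure.dirac (X j)

/-- The measure with density `ρ` with respect to Lebesgue measure. -/
def densMeas (ρ : E3 → ℝ) : Measure E3 :=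
  volume.withDensity fun x => ENNReal.ofReal (ρ x)

/-- `∬_{ℝ⁶ ∖ D} w dμ dν`, the integral of `w` over the complement of
the diagonal with respect to the product measure `μ ⊗ ν`. -/
def offDiagInt (w : E3 × E3 → ℝ) (μ ν : Measure E3) : ℝ :=
  ∫ p in {p : E3 × E3 | p.1 ≠ p.2}, w p ∂(μ.prod ν)

/-- `∬_{ℝ⁶ ∖ D} w d(μ−ν) d(μ−ν)`, expanded bilinearly. -/
def modDouble (w : E3 × E3 → ℝ) (μ ν : Measure E3) : ℝ :=
  offDiagInt w μ μ - offDiagInt w μ ν - offDiagInt w ν μ + offDiagInt w ν ν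

/-- The measure on `(ℝ³)^N` with density `ρ_N`. -/
def piDens (N : ℕ) (ρN : (Fin N → E3) → ℝ) : Measure (Fin N → E3) :=
  volume.withDensity fun X => ENNReal.ofReal (ρN X)

/-- Serfaty's modulated potential energy
`F_N(X_N, ρ) = N² ∬_{ℝ⁶∖D} V(x−y) d(μ_{X_N}−ρ) d(μ_{X_N}−ρ)`. -/
def FN (N : ℕ) (X : Fin N → E3) (ρ : E3 → ℝ) : ℝ :=
  (N : ℝ) ^ 2 * modDouble (fun p => V (p.1 - p.2)) (empMeas X) (densMeas ρ)

open scoped RealInnerProductSpace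

/-- The gradient `∇V(z) = −z/(4π|z|³)` of the Coulomb potential, for `z ≠ 0`. -/
def gradV (z : E3) : E3 := (-(4 * π * ‖z‖ ^ 3)⁻¹) • z

/-- Serfaty's functional
`F'_N(X_N,(ρ,u)) = N² ∬_{ℝ⁶∖D} (u(x)−u(y))·∇V(x−y) d(μ_{X_N}−ρ) d(μ_{X_N}−ρ)`. -/
def FN' (N : ℕ) (X : Fin N → E3) (ρ : E3 → ℝ) (u : E3 → E3) : ℝ :=
  (N : ℝ) ^ 2 *
    modDouble (fun p => ⟪u p.1 - u p.2, gradV (p.1 - p.2)⟫) (empMeas X) (densMeas ρ)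

section


open Filter Topology Set

/-! ### Part 1: radial integrals -/

/-- `|z|⁻²`. -/
def f0 (z : E3) : ℝ := (‖z‖ ^ 2)⁻¹

/-- truncated `|z|⁻²`. -/
def fT (η : ℝ) (z : E3) : ℝ := if η ≤ ‖z‖ then f0 z else 0

lemma f0_nonneg (z : E3) : 0 ≤ f0 z := by unfold f0; positivity

lemma f0_neg (z : E3) : f0 (-z) = f0 z := by simp [f0]

lemma f0_sub_comm (x y : E3) : f0 (x - y) = f0 (y - x) := by
  rw [← f0_neg, neg_sub]

lemma fT_nonneg (η : ℝ) (z : E3) : 0 ≤ fT η z := by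
  unfold fT; split_ifs; exacts [f0_nonneg z, le_rfl]

lemma fT_le (η : ℝ) (z : E3) : fT η z ≤ f0 z := by
  unfold fT; split_ifs; exacts [le_rfl, f0_nonneg z]

lemma measurable_f0 : Measurable f0 := by
  unfold f0; fun_prop

lemma measurable_fT (η : ℝ) : Measurable (fT η) := by
  unfold fT
  exact Measurable.ite (measurableSet_le measurable_const measurable_norm) measurable_f0
    measurable_const

lemma finrank_E3 : Module.finrank ℝ E3 = 3 := by simp

lemma radial_integrable {f : ℝ → ℝ} (h : IntegrableOn (fun y => y ^ 2 * f y) (Ioi 0)) :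
    Integrable (fun z : E3 => f ‖z‖) := by
  rw [integrable_fun_norm_addHaar volume (f := f)]
  rw [finrank_E3]
  simpa using h

/-- volume constant -/
def c1 : ℝ := 3 * volume.real (Metric.ball (0 : E3) 1)

lemma c1_pos : 0 < c1 := by
  unfold c1
  have : 0 < volume.real (Metric.ball (0 : E3) 1) :=
    ENNReal.toReal_pos (Metric.measure_ball_pos _ _ one_pos).ne' measure_ball_lt_top.ne
  positivity

lemma radial_integral (f : ℝ → ℝ) :
    ∫ z : E3, f ‖z‖ = c1 * ∫ y in Ioi (0:ℝ), y ^ 2 * f y := by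
  rw [integral_fun_norm_addHaar volume f, finrank_E3]
  simp [c1, mul_assoc]

lemma ball_f0 {η : ℝ} (hη : 0 < η) :
    Integrable (fun z : E3 => if ‖z‖ < η then f0 z else 0) ∧
    ∫ z : E3, (if ‖z‖ < η then f0 z else 0) = c1 * η := by
  have key : ∀ y ∈ Ioi (0:ℝ), y ^ 2 * (if y < η then (y^2)⁻¹ else 0)
      = (Iio η).indicator (fun _ => (1:ℝ)) y := by
    intro y hy
    have hy : (0:ℝ) < y := hy
    by_cases h : y < η
    · simp [h]; field_simp
    · simp [h]
  have e : (fun z : E3 => if ‖z‖ < η then f0 z else 0)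
      = fun z : E3 => (fun y : ℝ => if y < η then (y^2)⁻¹ else 0) ‖z‖ := rfl
  constructor
  · rw [e]
    apply radial_integrable (f := fun y : ℝ => if y < η then (y^2)⁻¹ else 0)
    refine IntegrableOn.congr_fun ?_ (fun y hy => (key y hy).symm) measurableSet_Ioi
    rw [integrableOn_indicator_iff measurableSet_Iio]
    rw [integrableOn_const_iff]
    right
    rw [Set.inter_comm, Ioi_inter_Iio]; simp
  · rw [e, radial_integral (fun y : ℝ => if y < η then (y^2)⁻¹ else 0)]
    rw [setIntegral_congr_fun measurableSet_Ioi key, setIntegral_indicator measurableSet_Iio,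
      Ioi_inter_Iio]
    simp [hη.le]

lemma fT_sq {η : ℝ} (hη : 0 < η) :
    Integrable (fun z : E3 => fT η z ^ 2) ∧ ∫ z : E3, fT η z ^ 2 = c1 / η := by
  have key : ∀ y ∈ Ioi (0:ℝ), y ^ 2 * (if η ≤ y then (y^2)⁻¹ else 0) ^ 2
      = (Ici η).indicator (fun y => y ^ (-2:ℝ)) y := by
    intro y hy
    have hy : (0:ℝ) < y := hy
    have : y ^ (-2:ℝ) = (y^2)⁻¹ := by
      rw [Real.rpow_neg hy.le]; norm_num
    by_cases h : η ≤ y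
    · simp [h, this]; field_simp
    · simp [h]
  have e : (fun z : E3 => fT η z ^ 2)
      = fun z : E3 => (fun y : ℝ => (if η ≤ y then (y^2)⁻¹ else 0) ^ 2) ‖z‖ := rfl
  have hI : Ioi 0 ∩ Ici η = Ici η := by
    ext y; simp; intro h; linarith
  constructor
  · rw [e]
    apply radial_integrable (f := fun y : ℝ => (if η ≤ y then (y^2)⁻¹ else 0) ^ 2)
    refine IntegrableOn.congr_fun ?_ (fun y hy => (key y hy).symm) measurableSet_Ioi
    rw [integrableOn_indicator_iff measurableSet_Ici, Set.inter_comm, hI,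
      integrableOn_Ici_iff_integrableOn_Ioi]
    exact integrableOn_Ioi_rpow_of_lt (by norm_num) hη
  · rw [e, radial_integral (fun y : ℝ => (if η ≤ y then (y^2)⁻¹ else 0) ^ 2)]
    rw [setIntegral_congr_fun measurableSet_Ioi key, setIntegral_indicator measurableSet_Ici, hI,
      integral_Ici_eq_integral_Ioi, integral_Ioi_rpow_of_lt (by norm_num) hη]
    norm_num
    rw [Real.rpow_neg_one]; rfl

lemma f0_mul_le {r : ℝ} (hr : 0 < r) (a b : E3) (h : r ≤ ‖a‖ + ‖b‖) :
    f0 a * f0 b ≤ f0 a * ((max (r/2) ‖a‖) ^ 2)⁻¹ + f0 b * ((max (r/2) ‖b‖) ^ 2)⁻¹ := by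
  have h1 : ∀ a b : E3, r ≤ ‖a‖ + ‖b‖ → ‖a‖ ≤ ‖b‖ →
      f0 a * f0 b ≤ f0 a * ((max (r/2) ‖a‖) ^ 2)⁻¹ := by
    intro a b h hab
    apply mul_le_mul_of_nonneg_left _ (f0_nonneg a)
    unfold f0
    have : max (r/2) ‖a‖ ≤ ‖b‖ := max_le (by linarith) hab
    have h0 : 0 < max (r/2) ‖a‖ := lt_max_of_lt_left (by linarith)
    gcongr
  rcases le_total ‖a‖ ‖b‖ with hab | hab
  · have := h1 a b h hab
    have : 0 ≤ f0 b * ((max (r/2) ‖b‖) ^ 2)⁻¹ := mul_nonneg (f0_nonneg b) (by positivity)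
    linarith
  · have := h1 b a (by linarith) hab
    have : 0 ≤ f0 a * ((max (r/2) ‖a‖) ^ 2)⁻¹ := mul_nonneg (f0_nonneg a) (by positivity)
    linarith

lemma integrable_aux {r : ℝ} (hr : 0 < r) :
    Integrable (fun z : E3 => f0 z * ((max r ‖z‖) ^ 2)⁻¹) := by
  apply radial_integrable (f := fun y => (y^2)⁻¹ * ((max r y)^2)⁻¹)
  have h1 : Integrable (fun y : ℝ => (r^2)⁻¹ * (1 + r^2) * (1 + y^2)⁻¹) :=
    integrable_inv_one_add_sq.const_mul _
  refine Integrable.mono' h1.integrableOn (by fun_prop) ?_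
  refine (ae_restrict_iff' measurableSet_Ioi).2 (Eventually.of_forall fun y hy => ?_)
  have hy : (0:ℝ) < y := hy
  have hm : 0 < max r y := lt_max_of_lt_left hr
  have e : y ^ 2 * ((y^2)⁻¹ * ((max r y)^2)⁻¹) = ((max r y)^2)⁻¹ := by field_simp
  rw [e, Real.norm_of_nonneg (by positivity)]
  have e2 : (r^2)⁻¹ * (1 + r^2) * (1 + y^2)⁻¹ = ((r^2) * (1 + r^2)⁻¹ * (1 + y^2))⁻¹ := by
    field_simp
  rw [e2]
  apply inv_anti₀ (by positivity)
  rw [mul_assoc, inv_mul_eq_div, mul_div_assoc', div_le_iff₀ (by positivity)]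
  have a1 : r ^ 2 ≤ max r y ^ 2 := by gcongr; exact le_max_left _ _
  have a2 : y ^ 2 ≤ max r y ^ 2 := by gcongr; exact le_max_right _ _
  nlinarith [sq_nonneg r, mul_le_mul_of_nonneg_left a2 (sq_nonneg r)]

lemma integrable_f0f0 {x y : E3} (h : x ≠ y) :
    Integrable (fun z : E3 => f0 (z - x) * f0 (z - y)) := by
  have hr : 0 < ‖x - y‖ := norm_pos_iff.2 (sub_ne_zero.2 h)
  have h1 := integrable_aux (half_pos hr)
  refine Integrable.mono' ((h1.comp_sub_right x).add (h1.comp_sub_right y)) ?_ ?_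
  · exact ((measurable_f0.comp (measurable_id.sub_const x)).mul
      (measurable_f0.comp (measurable_id.sub_const y))).aestronglyMeasurable
  · refine Eventually.of_forall fun z => ?_
    rw [Real.norm_of_nonneg (mul_nonneg (f0_nonneg _) (f0_nonneg _))]
    apply f0_mul_le hr
    have : x - y = (z - y) - (z - x) := by abel
    rw [this]
    linarith [norm_sub_le (z - y) (z - x)]

/-- The Riesz composition. -/
def Rk (x y : E3) : ℝ := ∫ z, f0 (z - x) * f0 (z - y)

def e1 : E3 := EuclideanSpace.single 0 1

lemma norm_e1 : ‖e1‖ = 1 := by simp [e1]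

def c3 : ℝ := Rk 0 e1

lemma c3_pos : 0 < c3 := by
  have hne : (0 : E3) ≠ e1 := by
    intro h; have := norm_e1; rw [← h] at this; simp at this
  unfold c3 Rk
  rw [integral_pos_iff_support_of_nonneg (fun z => mul_nonneg (f0_nonneg _) (f0_nonneg _))
    (integrable_f0f0 hne)]
  have : ({0, e1}ᶜ : Set E3) ⊆ Function.support fun z => f0 (z - 0) * f0 (z - e1) := by
    intro z hz
    simp only [mem_compl_iff, mem_insert_iff, mem_singleton_iff, not_or] at hz
    simp [f0, hz.1, sub_eq_zero, hz.2]
  refine lt_of_lt_of_le ?_ (measure_mono this)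
  have hn : volume ({0, e1} : Set E3) = 0 := by
    exact (Set.toFinite _).measure_zero _
  have := measure_compl₀ (μ := (volume : Measure E3)) (s := {0, e1})
    ((Set.toFinite _).measurableSet.nullMeasurableSet) (by simp [hn])
  rw [this, hn]
  simp

lemma f0_isometry (T : E3 ≃ₗᵢ[ℝ] E3) (z : E3) : f0 (T z) = f0 z := by simp [f0]

lemma Rk_eq {x y : E3} (h : x ≠ y) : Rk x y = c3 / ‖x - y‖ := by
  set r := ‖x - y‖ with hr
  have hr0 : 0 < r := norm_pos_iff.2 (sub_ne_zero.2 h)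
  -- translate
  have t1 : Rk x y = ∫ z, f0 z * f0 (z - (y - x)) := by
    unfold Rk
    rw [← integral_add_right_eq_self _ x]
    congr 1; ext z; congr 2 <;> abel
  -- scale
  set v : E3 := r⁻¹ • (y - x) with hv
  have hvn : ‖v‖ = 1 := by
    rw [hv, norm_smul, norm_sub_rev, ← hr]; simp [abs_of_pos hr0, hr0.ne']
  have hyx : y - x = r • v := by rw [hv, smul_smul, mul_inv_cancel₀ hr0.ne', one_smul]
  have hsc : ∀ w : E3, f0 (r • w) = (r^2)⁻¹ * f0 w := by
    intro w; simp only [f0, norm_smul, Real.norm_eq_abs, abs_of_pos hr0, mul_pow, mul_inv]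
  have t2 : ∫ z, f0 z * f0 (z - (y - x)) = r⁻¹ * ∫ z, f0 z * f0 (z - v) := by
    have := Measure.integral_comp_smul (volume : Measure E3)
      (fun z => f0 z * f0 (z - (y - x))) r
    rw [finrank_E3] at this
    have e : (fun z : E3 => f0 (r • z) * f0 (r • z - (y - x)))
        = fun z => (r^4)⁻¹ * (f0 z * f0 (z - v)) := by
      ext z; rw [hyx, ← smul_sub, hsc, hsc]; ring
    rw [e, integral_const_mul, abs_of_pos (by positivity), smul_eq_mul] at this
    have h3 : ∫ z, f0 z * f0 (z - (y - x)) = r^3 * ((r^4)⁻¹ * ∫ z, f0 z * f0 (z - v)) := by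
      rw [this]; field_simp
    rw [h3]; field_simp
  -- rotate
  set T := (ℝ ∙ (e1 - v))ᗮ.reflection with hT
  have hTe : T e1 = v := Submodule.reflection_sub (by rw [norm_e1, hvn])
  have t3 : ∫ z, f0 z * f0 (z - v) = c3 := by
    have := (T.measurePreserving).integral_comp T.toHomeomorph.measurableEmbedding
      (fun z => f0 z * f0 (z - v))
    rw [← this]
    unfold c3 Rk
    congr 1; ext z
    rw [← hTe, ← map_sub, f0_isometry, f0_isometry, sub_zero]
  rw [t1, t2, t3]; field_simp



/-! ### Part 2: product kernels -/

/-- truncation of a feature -/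
def trunc (η : ℝ) (α : E3 → ℝ) (z : E3) : ℝ := if η ≤ ‖z‖ then α z else 0

lemma fT_eq (η : ℝ) : fT η = trunc η f0 := rfl

lemma measurable_trunc (η : ℝ) {α : E3 → ℝ} (h : Measurable α) : Measurable (trunc η α) := by
  unfold trunc
  exact Measurable.ite (measurableSet_le measurable_const measurable_norm) h
    measurable_const

lemma trunc_le (η : ℝ) {α : E3 → ℝ} (h : ∀ z, |α z| ≤ f0 z) (z : E3) :
    |trunc η α z| ≤ fT η z := by
  unfold trunc fT; split_ifs <;> simp [h z]

/-- product kernel -/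
def PP (m α β : E3 → ℝ) (x y : E3) : ℝ := ∫ z, m z * (α (z - x) * β (z - y))

lemma meas_shift {α : E3 → ℝ} (h : Measurable α) (x : E3) : Measurable fun z => α (z - x) :=
  h.comp (measurable_id.sub_const x)

lemma integrable_fTfT {η : ℝ} (hη : 0 < η) (x y : E3) :
    Integrable (fun z => fT η (z - x) * fT η (z - y)) ∧
    ∫ z, fT η (z - x) * fT η (z - y) ≤ c1 / η := by
  have hx := (fT_sq hη).1.comp_sub_right x
  have hy := (fT_sq hη).1.comp_sub_right y
  have hs := (hx.add hy).const_mul (1/2 : ℝ)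
  have hle : ∀ z, fT η (z - x) * fT η (z - y) ≤
      (1/2 : ℝ) * (fT η (z - x) ^ 2 + fT η (z - y) ^ 2) := by
    intro z; nlinarith [sq_nonneg (fT η (z - x) - fT η (z - y))]
  have hi : Integrable (fun z => fT η (z - x) * fT η (z - y)) := by
    refine Integrable.mono' hs ((meas_shift (measurable_fT η) x).mul
      (meas_shift (measurable_fT η) y)).aestronglyMeasurable (Eventually.of_forall fun z => ?_)
    rw [Real.norm_of_nonneg (mul_nonneg (fT_nonneg _ _) (fT_nonneg _ _))]
    exact hle z
  refine ⟨hi, ?_⟩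
  calc ∫ z, fT η (z - x) * fT η (z - y)
      ≤ ∫ z, (1/2 : ℝ) * (fT η (z - x) ^ 2 + fT η (z - y) ^ 2) :=
        integral_mono hi hs hle
    _ = c1 / η := by
        rw [integral_const_mul, integral_add hx hy,
          integral_sub_right_eq_self (fun z => fT η z ^ 2),
          integral_sub_right_eq_self (fun z => fT η z ^ 2), (fT_sq hη).2]
        ring

lemma PP_trunc_integrable {η : ℝ} (hη : 0 < η) {m α β : E3 → ℝ} {m0 : ℝ}
    (hm : Measurable m) (hα : Measurable α) (hβ : Measurable β)
    (bm : ∀ z, |m z| ≤ m0) (bα : ∀ z, |α z| ≤ fT η z) (bβ : ∀ z, |β z| ≤ fT η z) (x y : E3) :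
    Integrable (fun z => m z * (α (z - x) * β (z - y))) := by
  refine Integrable.mono' ((integrable_fTfT hη x y).1.const_mul m0)
    (hm.mul ((meas_shift hα x).mul (meas_shift hβ y))).aestronglyMeasurable
    (Eventually.of_forall fun z => ?_)
  rw [norm_mul, norm_mul]
  simp only [Real.norm_eq_abs]
  exact mul_le_mul (bm z) (mul_le_mul (bα _) (bβ _) (abs_nonneg _) (fT_nonneg _ _))
    (by positivity) ((abs_nonneg _).trans (bm z))

lemma PP_trunc_norm_le {η : ℝ} (hη : 0 < η) {m α β : E3 → ℝ} {m0 : ℝ}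
    (hm : Measurable m) (hα : Measurable α) (hβ : Measurable β)
    (bm : ∀ z, |m z| ≤ m0) (bα : ∀ z, |α z| ≤ fT η z) (bβ : ∀ z, |β z| ≤ fT η z) (x y : E3) :
    ∫ z, ‖m z * (α (z - x) * β (z - y))‖ ≤ m0 * (c1 / η) := by
  have h0 : 0 ≤ m0 := (abs_nonneg _).trans (bm 0)
  calc ∫ z, ‖m z * (α (z - x) * β (z - y))‖
      ≤ ∫ z, m0 * (fT η (z - x) * fT η (z - y)) := by
        refine integral_mono (PP_trunc_integrable hη hm hα hβ bm bα bβ x y).norm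
          ((integrable_fTfT hη x y).1.const_mul m0) fun z => ?_
        simp only [norm_mul, Real.norm_eq_abs]
        exact mul_le_mul (bm z) (mul_le_mul (bα _) (bβ _) (abs_nonneg _) (fT_nonneg _ _))
          (by positivity) ((abs_nonneg _).trans (bm z))
    _ ≤ _ := by
        rw [integral_const_mul]
        exact mul_le_mul_of_nonneg_left (integrable_fTfT hη x y).2 h0

lemma PP_trunc_le {η : ℝ} (hη : 0 < η) {m α β : E3 → ℝ} {m0 : ℝ}
    (hm : Measurable m) (hα : Measurable α) (hβ : Measurable β)
    (bm : ∀ z, |m z| ≤ m0) (bα : ∀ z, |α z| ≤ fT η z) (bβ : ∀ z, |β z| ≤ fT η z) (x y : E3) :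
    |PP m α β x y| ≤ m0 * (c1 / η) :=
  (norm_integral_le_integral_norm _).trans (PP_trunc_norm_le hη hm hα hβ bm bα bβ x y)

lemma PP_meas {m α β : E3 → ℝ}
    (hm : Measurable m) (hα : Measurable α) (hβ : Measurable β) :
    Measurable (fun p : E3 × E3 => PP m α β p.1 p.2) := by
  have : StronglyMeasurable (fun q : (E3 × E3) × E3 =>
      m q.2 * (α (q.2 - q.1.1) * β (q.2 - q.1.2))) := by
    apply Measurable.stronglyMeasurable
    refine (hm.comp measurable_snd).mul ((hα.comp ?_).mul (hβ.comp ?_)) <;> fun_prop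
  exact this.integral_prod_right.measurable

/-- The error kernel. -/
def Gk (η : ℝ) (x y : E3) : ℝ := Rk x y - PP 1 (fT η) (fT η) x y

lemma Gk_eq {η : ℝ} (hη : 0 < η) {x y : E3} (h : x ≠ y) :
    Gk η x y = ∫ z, (f0 (z - x) * f0 (z - y) - fT η (z - x) * fT η (z - y)) := by
  rw [integral_sub (integrable_f0f0 h) (integrable_fTfT hη x y).1]
  simp [Gk, PP, Rk]

lemma fTfT_le (η : ℝ) (a b : E3) : fT η a * fT η b ≤ f0 a * f0 b :=
  mul_le_mul (fT_le _ _) (fT_le _ _) (fT_nonneg _ _) (f0_nonneg _)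

lemma Gk_nonneg {η : ℝ} (hη : 0 < η) {x y : E3} (h : x ≠ y) : 0 ≤ Gk η x y := by
  rw [Gk_eq hη h]
  exact integral_nonneg fun z => sub_nonneg.2 (fTfT_le _ _ _)

lemma PP_integrable {m α β : E3 → ℝ} {m0 : ℝ}
    (hm : Measurable m) (hα : Measurable α) (hβ : Measurable β)
    (bm : ∀ z, |m z| ≤ m0) (bα : ∀ z, |α z| ≤ f0 z) (bβ : ∀ z, |β z| ≤ f0 z) {x y : E3}
    (h : x ≠ y) :
    Integrable (fun z => m z * (α (z - x) * β (z - y))) := by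
  refine Integrable.mono' ((integrable_f0f0 h).const_mul m0)
    (hm.mul ((meas_shift hα x).mul (meas_shift hβ y))).aestronglyMeasurable
    (Eventually.of_forall fun z => ?_)
  rw [norm_mul, norm_mul]
  simp only [Real.norm_eq_abs]
  exact mul_le_mul (bm z) (mul_le_mul (bα _) (bβ _) (abs_nonneg _) (f0_nonneg _))
    (by positivity) ((abs_nonneg _).trans (bm z))

lemma PP_diff_le {η : ℝ} (hη : 0 < η) {m α β : E3 → ℝ} {m0 : ℝ}
    (hm : Measurable m) (hα : Measurable α) (hβ : Measurable β)
    (bm : ∀ z, |m z| ≤ m0) (bα : ∀ z, |α z| ≤ f0 z) (bβ : ∀ z, |β z| ≤ f0 z) {x y : E3}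
    (h : x ≠ y) :
    |PP m α β x y - PP m (trunc η α) (trunc η β) x y| ≤ m0 * Gk η x y := by
  have i1 := PP_integrable hm hα hβ bm bα bβ h
  have i2 := PP_trunc_integrable hη hm (measurable_trunc η hα) (measurable_trunc η hβ) bm
    (trunc_le η bα) (trunc_le η bβ) x y
  unfold PP
  rw [← integral_sub i1 i2, Gk_eq hη h, ← integral_const_mul, ← Real.norm_eq_abs]
  refine norm_integral_le_of_norm_le
    (((integrable_f0f0 h).sub (integrable_fTfT hη x y).1).const_mul m0)
    (Eventually.of_forall fun z => ?_)
  rw [← mul_sub, norm_mul]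
  simp only [Real.norm_eq_abs]
  refine mul_le_mul (bm z) ?_ (abs_nonneg _) ((abs_nonneg _).trans (bm z))
  have key : |α (z - x) * β (z - y)| ≤ f0 (z - x) * f0 (z - y) := by
    rw [abs_mul]; exact mul_le_mul (bα _) (bβ _) (abs_nonneg _) (f0_nonneg _)
  rw [abs_mul] at key
  unfold trunc fT
  split_ifs <;> simp [key]

def c2 : ℝ := 2 * c3 + 8 * c1

lemma c2_pos : 0 < c2 := by have := c3_pos; have := c1_pos; unfold c2; positivity

lemma Gk_le {η : ℝ} (hη : 0 < η) {x y : E3} (h : x ≠ y) :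
    Gk η x y ≤ c2 * η * f0 (x - y) := by
  have hr : 0 < ‖x - y‖ := norm_pos_iff.2 (sub_ne_zero.2 h)
  have hc1 := c1_pos
  have hc3 := c3_pos
  rcases le_or_gt ‖x - y‖ (2 * η) with hh | hh
  · have h1 : Gk η x y ≤ c3 / ‖x - y‖ := by
      rw [← Rk_eq h]; unfold Gk
      have : 0 ≤ PP 1 (fT η) (fT η) x y := by
        unfold PP
        exact integral_nonneg fun z => by
          simp; exact mul_nonneg (fT_nonneg _ _) (fT_nonneg _ _)
      linarith
    refine h1.trans ?_
    unfold f0 c2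
    rw [← div_eq_mul_inv, div_le_div_iff₀ hr (by positivity)]
    have : c3 * ‖x - y‖ ≤ (2 * c3 + 8 * c1) * η := by nlinarith
    nlinarith
  · have hb := (ball_f0 hη)
    set b : E3 → ℝ := fun z => if ‖z‖ < η then f0 z else 0 with hbdef
    have hb0 : ∀ z, 0 ≤ b z := by intro z; simp only [hbdef]; split_ifs; exacts [f0_nonneg z, le_rfl]
    have hpt : ∀ z, f0 (z - x) * f0 (z - y) - fT η (z - x) * fT η (z - y)
        ≤ (4 * f0 (x - y)) * (b (z - x) + b (z - y)) := by
      intro z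
      have aux : ∀ a c : E3, ‖x - y‖ ≤ ‖a‖ + ‖c‖ → ‖a‖ < η → f0 a * f0 c ≤ 4 * f0 (x - y) * b a := by
        intro a c h1 h2
        have : b a = f0 a := by simp [hbdef, h2]
        rw [this, mul_comm]
        apply mul_le_mul_of_nonneg_right _ (f0_nonneg a)
        unfold f0
        rw [← div_eq_mul_inv, ← one_div, div_le_div_iff₀]
        · nlinarith [norm_nonneg a]
        · have : 0 < ‖c‖ := by linarith
          positivity
        · positivity
      have tri : ‖x - y‖ ≤ ‖z - x‖ + ‖z - y‖ := by
        have : x - y = (z - y) - (z - x) := by abel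
        rw [this]
        linarith [norm_sub_le (z - y) (z - x)]
      have hnn : 0 ≤ 4 * f0 (x - y) := by have := f0_nonneg (x - y); positivity
      have := fT_nonneg η (z - x)
      have := fT_nonneg η (z - y)
      have n1 := mul_nonneg hnn (hb0 (z - x))
      have n2 := mul_nonneg hnn (hb0 (z - y))
      have n3 := mul_nonneg (fT_nonneg η (z - x)) (fT_nonneg η (z - y))
      rw [mul_add]
      by_cases h1 : ‖z - x‖ < η
      · have := aux (z - x) (z - y) tri h1
        linarith
      · by_cases h2 : ‖z - y‖ < η
        · have := aux (z - y) (z - x) (by linarith) h2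
          linarith [mul_comm (f0 (z - x)) (f0 (z - y))]
        · have : fT η (z - x) * fT η (z - y) = f0 (z - x) * f0 (z - y) := by
            simp [fT, not_lt.1 h1, not_lt.1 h2]
          linarith
    have hbx := hb.1.comp_sub_right x
    have hby := hb.1.comp_sub_right y
    rw [Gk_eq hη h]
    calc _ ≤ ∫ z, (4 * f0 (x - y)) * (b (z - x) + b (z - y)) :=
          integral_mono ((integrable_f0f0 h).sub (integrable_fTfT hη x y).1)
            ((hbx.add hby).const_mul _) hpt
      _ = (4 * f0 (x - y)) * (c1 * η + c1 * η) := by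
          rw [integral_const_mul, integral_add hbx hby,
            integral_sub_right_eq_self b, integral_sub_right_eq_self b, hb.2]
      _ ≤ _ := by
          unfold c2
          have := f0_nonneg (x - y)
          have : 0 ≤ c3 * η * f0 (x - y) := by positivity
          nlinarith



/-! ### Part 3: integration by parts -/

lemma integrable_bracket : Integrable (fun z : E3 => ((1 + ‖z‖) ^ 4)⁻¹) := by
  have := integrable_one_add_norm (E := E3) (μ := volume) (r := 4) (by rw [finrank_E3]; norm_num)
  refine this.congr (Eventually.of_forall fun z => ?_)
  have h : 0 ≤ 1 + ‖z‖ := by positivity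
  simp only [Real.rpow_neg h]
  norm_cast

lemma ibp {v g g' : E3 → ℝ} {K : ℝ≥0} {b C : ℝ} {e : E3} (he : ‖e‖ = 1)
    (hv : LipschitzWith K v) (bv : ∀ z, |v z| ≤ b)
    (hg : Measurable g) (hg' : Measurable g')
    (hd : ∀ z, HasDerivAt (fun t : ℝ => g (z + t • e)) (g' z) 0)
    (bg : ∀ z, |g z| ≤ C * ((1 + ‖z‖) ^ 4)⁻¹) (bg' : ∀ z, |g' z| ≤ C * ((1 + ‖z‖) ^ 4)⁻¹) :
    ∫ z, lineDeriv ℝ v z e * g z = - ∫ z, v z * g' z := by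
  have hC : 0 ≤ C := by
    have := (abs_nonneg _).trans (bg 0); simpa using this
  have hb : 0 ≤ b := (abs_nonneg _).trans (bv 0)
  have ig : Integrable g := Integrable.mono' (integrable_bracket.const_mul C)
    hg.aestronglyMeasurable (Eventually.of_forall bg)
  have hvm : Measurable v := hv.continuous.measurable
  have T1 := hv.integral_inv_smul_sub_mul_tendsto_integral_lineDeriv_mul (μ := volume) ig e
  have eq1 : ∀ t : ℝ, ∫ x, (t⁻¹ • (v (x + t • e) - v x)) * g x
      = ∫ x, v x * (t⁻¹ * (g (x - t • e) - g x)) := by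
    intro t
    have igv : ∀ {w : E3 → ℝ} (_ : Integrable w) (c : E3), Integrable (fun x => v (x + c) * w x) := by
      intro w hw c
      refine hw.bdd_mul (c := b) ?_ (Eventually.of_forall fun x => bv _)
      exact (hvm.comp (measurable_id.add_const c)).aestronglyMeasurable
    have i1 : Integrable (fun x => v (x + t • e) * g x) := igv ig _
    have i2 : Integrable (fun x => v x * g x) := by simpa using igv ig 0
    have i3 : Integrable (fun x => v x * g (x - t • e)) := by
      simpa using igv (ig.comp_sub_right (t • e)) 0
    have s1 : ∫ x, v (x + t • e) * g x = ∫ x, v x * g (x - t • e) := by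
      rw [← integral_add_right_eq_self (fun x => v x * g (x - t • e)) (t • e)]
      simp
    calc ∫ x, (t⁻¹ • (v (x + t • e) - v x)) * g x
        = ∫ x, t⁻¹ * (v (x + t • e) * g x - v x * g x) := by
          congr 1; ext x; simp only [smul_eq_mul]; ring
      _ = t⁻¹ * ((∫ x, v x * g (x - t • e)) - ∫ x, v x * g x) := by
          rw [integral_const_mul, integral_sub i1 i2, s1]
      _ = ∫ x, t⁻¹ * (v x * g (x - t • e) - v x * g x) := by
          rw [integral_const_mul, integral_sub i3 i2]
      _ = _ := by congr 1; ext x; ring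
  have hds : ∀ z (s : ℝ), HasDerivAt (fun t : ℝ => g (z + t • e)) (g' (z + s • e)) s := by
    intro z s
    have h1 := hd (z + s • e)
    have h2 : HasDerivAt (fun t : ℝ => t - s) 1 s := (hasDerivAt_id s).sub_const s
    have h3 := HasDerivAt.comp_of_eq s h1 h2 (by simp)
    simp only [mul_one] at h3
    refine h3.congr_of_eventuallyEq (Eventually.of_forall fun t => ?_)
    simp only [Function.comp]
    congr 1
    rw [sub_smul]; abel
  have T2 : Tendsto (fun t : ℝ => ∫ x, v x * (t⁻¹ * (g (x - t • e) - g x))) (𝓝[>] 0)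
      (𝓝 (∫ x, v x * (- g' x))) := by
    apply tendsto_integral_filter_of_dominated_convergence
      (fun x => b * (16 * C * ((1 + ‖x‖) ^ 4)⁻¹))
    · refine Eventually.of_forall fun t => Measurable.aestronglyMeasurable ?_
      exact hvm.mul (((hg.comp (measurable_id.sub_const _)).sub hg).const_mul _)
    · have : Ioc (0:ℝ) 1 ∈ 𝓝[>] (0:ℝ) := Ioc_mem_nhdsGT one_pos
      filter_upwards [this] with t ht
      refine Eventually.of_forall fun x => ?_
      rw [norm_mul, norm_mul]
      refine mul_le_mul (bv x) ?_ (by positivity) hb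
      have mv := Convex.norm_image_sub_le_of_norm_hasDerivWithin_le
        (f := fun s : ℝ => g (x + s • e)) (f' := fun s => g' (x + s • e))
        (C := 16 * C * ((1 + ‖x‖) ^ 4)⁻¹) (s := Icc (-1) 0) (x := 0) (y := -t)
        (fun s _ => (hds x s).hasDerivWithinAt) ?_ (convex_Icc _ _) (by simp)
        (by constructor <;> linarith [ht.1, ht.2])
      · simp only [neg_smul, zero_smul, add_zero, ← sub_eq_add_neg] at mv
        rw [norm_inv, Real.norm_of_nonneg ht.1.le, inv_mul_le_iff₀ ht.1]
        refine mv.trans (le_of_eq ?_)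
        simp [abs_of_pos ht.1]; ring
      · intro s hs
        refine (bg' _).trans ?_
        rw [mul_comm 16 C, mul_assoc]
        apply mul_le_mul_of_nonneg_left _ hC
        have h1 : 1 + ‖x‖ ≤ 2 * (1 + ‖x + s • e‖) := by
          have h2 : ‖x‖ ≤ ‖x + s • e‖ + ‖s • e‖ := by
            have := norm_sub_le (x + s • e) (s • e)
            simpa using this
          have h3 : ‖s • e‖ ≤ 1 := by
            rw [norm_smul, he, mul_one, Real.norm_eq_abs, abs_le]
            constructor <;> linarith [hs.1, hs.2]
          linarith [norm_nonneg (x + s • e)]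
        have h4 : (1 + ‖x‖) ^ 4 ≤ 16 * (1 + ‖x + s • e‖) ^ 4 := by
          calc (1 + ‖x‖) ^ 4 ≤ (2 * (1 + ‖x + s • e‖)) ^ 4 := by gcongr
            _ = _ := by ring
        rw [← div_eq_mul_inv, ← one_div, div_le_div_iff₀ (by positivity) (by positivity)]
        linarith
    · exact ((integrable_bracket.const_mul (16 * C)).const_mul b)
    · refine Eventually.of_forall fun x => ?_
      apply Tendsto.const_mul
      have h1 : HasDerivAt (fun t : ℝ => g (x + (-t) • e)) (g' x * (-1)) 0 := by
        have h0 : HasDerivAt (fun t : ℝ => g (x + t • e)) (g' x) (-0) := by simpa using hd x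
        exact HasDerivAt.comp (0:ℝ) h0 (hasDerivAt_neg (0:ℝ))
      have h2 := h1.tendsto_slope_zero_right
      simp only [zero_add, neg_zero, zero_smul, add_zero, smul_eq_mul, mul_neg, mul_one,
        neg_smul, ← sub_eq_add_neg] at h2
      exact h2
  have T1' : Tendsto (fun t : ℝ => ∫ x, v x * (t⁻¹ * (g (x - t • e) - g x))) (𝓝[>] 0)
      (𝓝 (∫ x, lineDeriv ℝ v x e * g x)) := by
    refine T1.congr fun t => eq1 t
  rw [tendsto_nhds_unique T1' T2, ← integral_neg]
  congr 1; ext x; ring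



/-! ### Part 4: the regularised Coulomb field -/

def phi (s : ℝ) : ℝ := if s ≤ 1 then (5 - 3 * s) / 2 else s ^ (-(3/2) : ℝ)
def dphi (s : ℝ) : ℝ := if s ≤ 1 then -(3/2) else -(3/2) * s ^ (-(5/2) : ℝ)

lemma hasDerivAt_phi (s : ℝ) : HasDerivAt phi (dphi s) s := by
  have l : ∀ s, HasDerivAt (fun s : ℝ => (5 - 3 * s) / 2) (-(3/2)) s := by
    intro s
    have := (((hasDerivAt_id s).const_mul 3).const_sub 5).div_const 2
    exact this.congr_deriv (by norm_num)
  have r : ∀ s, 0 < s → HasDerivAt (fun s : ℝ => s ^ (-(3/2) : ℝ)) (-(3/2) * s ^ (-(5/2) : ℝ)) s := by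
    intro s hs
    have := Real.hasDerivAt_rpow_const (x := s) (p := -(3/2)) (Or.inl hs.ne')
    exact this.congr_deriv (by norm_num)
  rcases lt_trichotomy s 1 with h | h | h
  · have : dphi s = -(3/2) := by simp [dphi, h.le]
    rw [this]
    refine (l s).congr_of_eventuallyEq ?_
    filter_upwards [Iio_mem_nhds h] with t ht
    simp [phi, (show t < 1 from ht).le]
  · subst h
    have e : dphi 1 = -(3/2) := by simp [dphi]
    rw [e]
    have h1 : HasDerivWithinAt phi (-(3/2)) (Iic 1) 1 := by
      refine (l 1).hasDerivWithinAt.congr (fun t ht => ?_) ?_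
      · simp [phi, show t ≤ 1 from ht]
      · simp [phi]
    have h2 : HasDerivWithinAt phi (-(3/2)) (Ici 1) 1 := by
      have r1 := r 1 one_pos
      simp only [Real.one_rpow, mul_one] at r1
      have v1 : phi 1 = 1 := by norm_num [phi]
      refine r1.hasDerivWithinAt.congr (fun t ht => ?_) ?_
      · rcases eq_or_lt_of_le (show 1 ≤ t from ht) with h | h
        · rw [← h, v1]; simp
        · simp [phi, not_le.2 h]
      · rw [v1]; simp
    have := h1.union h2
    rw [Iic_union_Ici] at this
    exact hasDerivWithinAt_univ.1 this
  · have : dphi s = -(3/2) * s ^ (-(5/2) : ℝ) := by simp [dphi, not_le.2 h]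
    rw [this]
    refine (r s (by linarith)).congr_of_eventuallyEq ?_
    filter_upwards [Ioi_mem_nhds h] with t ht
    simp [phi, not_le.2 (show 1 < t from ht)]

lemma measurable_phi : Measurable phi := by
  have : Continuous phi := continuous_iff_continuousAt.2 fun s => (hasDerivAt_phi s).continuousAt
  exact this.measurable

lemma measurable_dphi : Measurable dphi := by
  unfold dphi
  exact Measurable.ite measurableSet_Iic measurable_const (by fun_prop)

lemma phi_sq_of_gt {t : ℝ} (ht : 1 < t) : phi (t ^ 2) = (t ^ 3)⁻¹ := by
  have h : ¬ t ^ 2 ≤ 1 := by nlinarith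
  have h0 : 0 ≤ t := by linarith
  simp only [phi, h, if_false]
  rw [← Real.rpow_natCast t 2, ← Real.rpow_mul h0, ← Real.rpow_natCast t 3, ← Real.rpow_neg h0]
  norm_num

lemma dphi_sq_of_gt {t : ℝ} (ht : 1 < t) : dphi (t ^ 2) = -(3/2) * (t ^ 5)⁻¹ := by
  have h : ¬ t ^ 2 ≤ 1 := by nlinarith
  have h0 : 0 ≤ t := by linarith
  simp only [dphi, h, if_false]
  rw [← Real.rpow_natCast t 2, ← Real.rpow_mul h0, ← Real.rpow_natCast t 5, ← Real.rpow_neg h0]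
  norm_num

lemma phi_sq_of_le {t : ℝ} (h0 : 0 ≤ t) (ht : t ≤ 1) : phi (t ^ 2) = (5 - 3 * t ^ 2) / 2 := by
  have h : t ^ 2 ≤ 1 := by nlinarith
  simp [phi, h]

lemma dphi_sq_of_le {t : ℝ} (h0 : 0 ≤ t) (ht : t ≤ 1) : dphi (t ^ 2) = -(3/2) := by
  have h : t ^ 2 ≤ 1 := by nlinarith
  simp [dphi, h]

/-- `phi (t^2) t³ ≤ 5/2` -/
lemma phi_bound {t : ℝ} (h0 : 0 ≤ t) : |phi (t ^ 2)| * t ^ 3 ≤ 5 / 2 := by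
  rcases le_or_gt t 1 with h | h
  · rw [phi_sq_of_le h0 h, abs_of_nonneg (by nlinarith)]
    have : t ^ 3 ≤ 1 := pow_le_one₀ h0 h
    have : 0 ≤ t ^ 3 := by positivity
    nlinarith [sq_nonneg t]
  · rw [phi_sq_of_gt h, abs_of_nonneg (by positivity), inv_mul_cancel₀ (by positivity)]
    norm_num

lemma phi_bound2 {t : ℝ} (h0 : 0 ≤ t) : |phi (t ^ 2)| * t ≤ 10 * ((1 + t) ^ 2)⁻¹ := by
  rw [← div_eq_mul_inv, le_div_iff₀ (by positivity)]
  rcases le_or_gt t 1 with h | h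
  · rw [phi_sq_of_le h0 h, abs_of_nonneg (by nlinarith)]
    have a1 : (5 - 3 * t ^ 2) / 2 ≤ 5 / 2 := by nlinarith [sq_nonneg t]
    have a2 : 0 ≤ (5 - 3 * t ^ 2) / 2 := by nlinarith
    calc (5 - 3 * t ^ 2) / 2 * t * (1 + t) ^ 2 ≤ 5 / 2 * 1 * (1 + 1) ^ 2 := by gcongr
      _ = 10 := by norm_num
  · rw [phi_sq_of_gt h, abs_of_nonneg (by positivity)]
    have : (t ^ 3)⁻¹ * t * (1 + t) ^ 2 = (1 + t) ^ 2 / t ^ 2 := by field_simp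
    rw [this, div_le_iff₀ (by positivity)]
    nlinarith

lemma dphi_bound {t : ℝ} (h0 : 0 ≤ t) :
    |phi (t ^ 2)| + 2 * t ^ 2 * |dphi (t ^ 2)| ≤ 22 * ((1 + t) ^ 2)⁻¹ := by
  rw [← div_eq_mul_inv, le_div_iff₀ (by positivity)]
  rcases le_or_gt t 1 with h | h
  · rw [phi_sq_of_le h0 h, dphi_sq_of_le h0 h, abs_of_nonneg (by nlinarith), abs_neg,
      abs_of_nonneg (by norm_num)]
    have a1 : (5 - 3 * t ^ 2) / 2 + 2 * t ^ 2 * (3 / 2) ≤ 11 / 2 := by nlinarith [sq_nonneg t]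
    calc ((5 - 3 * t ^ 2) / 2 + 2 * t ^ 2 * (3 / 2)) * (1 + t) ^ 2 ≤ 11 / 2 * (1 + 1) ^ 2 := by
          gcongr
      _ = 22 := by norm_num
  · rw [phi_sq_of_gt h, dphi_sq_of_gt h, abs_of_nonneg (by positivity), abs_mul, abs_neg,
      abs_of_nonneg (by norm_num : (0:ℝ) ≤ 3/2), abs_of_nonneg (by positivity)]
    have : ((t ^ 3)⁻¹ + 2 * t ^ 2 * (3 / 2 * (t ^ 5)⁻¹)) * (1 + t) ^ 2
        = 4 * (1 + t) ^ 2 / t ^ 3 := by field_simp; ring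
    rw [this, div_le_iff₀ (by positivity)]
    have : (1 + t) ^ 2 ≤ 4 * t ^ 2 := by nlinarith
    nlinarith [pow_pos (show 0 < t by linarith) 2]

/-- `div` profile -/
def qq (w : E3) : ℝ := if ‖w‖ < 1 then 15 / 2 * (1 - ‖w‖ ^ 2) else 0

lemma qq_eq {t : ℝ} (h0 : 0 ≤ t) :
    3 * phi (t ^ 2) + 2 * t ^ 2 * dphi (t ^ 2) = if t < 1 then 15 / 2 * (1 - t ^ 2) else 0 := by
  rcases le_or_gt t 1 with h | h
  · rw [phi_sq_of_le h0 h, dphi_sq_of_le h0 h]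
    rcases eq_or_lt_of_le h with h | h
    · subst h; norm_num
    · simp [h]; ring
  · rw [phi_sq_of_gt h, dphi_sq_of_gt h]
    simp [not_lt.2 h.le]; field_simp; norm_num

/-- regularised field -/
def Bf (ε : ℝ) (j : Fin 3) (z : E3) : ℝ := (ε ^ 3)⁻¹ * phi ((‖z‖ / ε) ^ 2) * z j

/-- its derivatives -/
def dBf (ε : ℝ) (i j : Fin 3) (z : E3) : ℝ :=
  (ε ^ 3)⁻¹ * (2 * (ε ^ 2)⁻¹ * dphi ((‖z‖ / ε) ^ 2) * z i * z j
    + if i = j then phi ((‖z‖ / ε) ^ 2) else 0)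

/-- the Coulomb field -/
def Af (j : Fin 3) (z : E3) : ℝ := (‖z‖ ^ 3)⁻¹ * z j

lemma measurable_coord (j : Fin 3) : Measurable (fun z : E3 => z j) := by fun_prop

lemma measurable_Bf (ε : ℝ) (j : Fin 3) : Measurable (Bf ε j) := by
  unfold Bf
  have := measurable_phi
  fun_prop

lemma measurable_Af (j : Fin 3) : Measurable (Af j) := by
  unfold Af; fun_prop

lemma measurable_dBf (ε : ℝ) (i j : Fin 3) : Measurable (dBf ε i j) := by
  unfold dBf
  have := measurable_phi
  have := measurable_dphi
  split_ifs <;> fun_prop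

lemma abs_coord_le (z : E3) (j : Fin 3) : |z j| ≤ ‖z‖ := by
  have := EuclideanSpace.norm_eq z
  simpa using PiLp.norm_apply_le z j

lemma Af_le (j : Fin 3) (z : E3) : |Af j z| ≤ f0 z := by
  unfold Af f0
  rcases eq_or_ne z 0 with h | h
  · simp [h]
  have : 0 < ‖z‖ := norm_pos_iff.2 h
  rw [abs_mul, abs_of_nonneg (by positivity)]
  calc (‖z‖ ^ 3)⁻¹ * |z j| ≤ (‖z‖ ^ 3)⁻¹ * ‖z‖ := by gcongr; exact abs_coord_le z j
    _ = _ := by field_simp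

lemma Bf_eq_Af {ε : ℝ} (hε : 0 < ε) (j : Fin 3) {z : E3} (h : ε < ‖z‖) : Bf ε j z = Af j z := by
  unfold Bf Af
  rw [phi_sq_of_gt ((one_lt_div hε).2 h)]
  have : 0 < ‖z‖ := hε.trans h
  field_simp

lemma Bf_le {ε : ℝ} (hε : 0 < ε) (j : Fin 3) (z : E3) : |Bf ε j z| ≤ 5 / 2 * f0 z := by
  unfold Bf f0
  rcases eq_or_ne z 0 with h | h
  · simp [h]
  have hz : 0 < ‖z‖ := norm_pos_iff.2 h
  have hb := phi_bound (t := ‖z‖ / ε) (by positivity)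
  rw [abs_mul, abs_mul, abs_of_nonneg (by positivity : 0 ≤ (ε ^ 3)⁻¹)]
  calc (ε ^ 3)⁻¹ * |phi ((‖z‖ / ε) ^ 2)| * |z j|
      ≤ (ε ^ 3)⁻¹ * |phi ((‖z‖ / ε) ^ 2)| * ‖z‖ := by gcongr; exact abs_coord_le z j
    _ = (|phi ((‖z‖ / ε) ^ 2)| * (‖z‖ / ε) ^ 3) * (‖z‖ ^ 2)⁻¹ := by field_simp
    _ ≤ _ := by gcongr

lemma bracket_scale {ε : ℝ} (hε : 0 < ε) (hε1 : ε ≤ 1) (z : E3) :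
    ((1 + ‖z‖ / ε) ^ 2)⁻¹ ≤ ((1 + ‖z‖) ^ 2)⁻¹ := by
  have : ‖z‖ ≤ ‖z‖ / ε := by
    rw [le_div_iff₀ hε]; nlinarith [norm_nonneg z]
  gcongr

lemma Bf_decay {ε : ℝ} (hε : 0 < ε) (hε1 : ε ≤ 1) (j : Fin 3) (z : E3) :
    |Bf ε j z| ≤ 22 * (ε ^ 3)⁻¹ * ((1 + ‖z‖) ^ 2)⁻¹ := by
  unfold Bf
  have hb := phi_bound2 (t := ‖z‖ / ε) (by positivity)
  rw [abs_mul, abs_mul, abs_of_nonneg (by positivity : 0 ≤ (ε ^ 3)⁻¹)]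
  calc (ε ^ 3)⁻¹ * |phi ((‖z‖ / ε) ^ 2)| * |z j|
      ≤ (ε ^ 3)⁻¹ * |phi ((‖z‖ / ε) ^ 2)| * ‖z‖ := by gcongr; exact abs_coord_le z j
    _ = (ε ^ 3)⁻¹ * ε * (|phi ((‖z‖ / ε) ^ 2)| * (‖z‖ / ε)) := by field_simp
    _ ≤ (ε ^ 3)⁻¹ * 1 * (10 * ((1 + ‖z‖) ^ 2)⁻¹) := by
        have hb1 := mul_le_mul_of_nonneg_left (bracket_scale hε hε1 z) (by norm_num : (0:ℝ) ≤ 10)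
        have hb2 := hb.trans hb1
        refine mul_le_mul ?_ hb2 (by positivity) (by positivity)
        gcongr
    _ ≤ _ := by
        have : 0 ≤ (ε ^ 3)⁻¹ * ((1 + ‖z‖) ^ 2)⁻¹ := by positivity
        nlinarith

lemma dBf_decay {ε : ℝ} (hε : 0 < ε) (hε1 : ε ≤ 1) (i j : Fin 3) (z : E3) :
    |dBf ε i j z| ≤ 22 * (ε ^ 3)⁻¹ * ((1 + ‖z‖) ^ 2)⁻¹ := by
  unfold dBf
  have hb := dphi_bound (t := ‖z‖ / ε) (by positivity)
  rw [abs_mul, abs_of_nonneg (by positivity : 0 ≤ (ε ^ 3)⁻¹), 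
    (by ring : 22 * (ε ^ 3)⁻¹ * ((1 + ‖z‖) ^ 2)⁻¹ = (ε ^ 3)⁻¹ * (22 * ((1 + ‖z‖) ^ 2)⁻¹))]
  apply mul_le_mul_of_nonneg_left _ (by positivity)
  have hb1 := mul_le_mul_of_nonneg_left (bracket_scale hε hε1 z) (by norm_num : (0:ℝ) ≤ 22)
  refine le_trans ?_ (hb.trans hb1)
  refine (abs_add_le _ _).trans ?_
  rw [add_comm]
  apply add_le_add
  · split_ifs
    · exact le_rfl
    · simp
  · rw [abs_mul, abs_mul, abs_mul, abs_of_nonneg (by positivity : 0 ≤ 2 * (ε ^ 2)⁻¹)]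
    calc 2 * (ε ^ 2)⁻¹ * |dphi ((‖z‖ / ε) ^ 2)| * |z i| * |z j|
        ≤ 2 * (ε ^ 2)⁻¹ * |dphi ((‖z‖ / ε) ^ 2)| * ‖z‖ * ‖z‖ := by
          gcongr <;> exact abs_coord_le z _
      _ = _ := by field_simp

lemma dBf_div {ε : ℝ} (hε : 0 < ε) (z : E3) :
    ∑ i, dBf ε i i z = (ε ^ 3)⁻¹ * qq (ε⁻¹ • z) := by
  have hn : ‖ε⁻¹ • z‖ = ‖z‖ / ε := by
    rw [norm_smul, norm_inv, Real.norm_of_nonneg hε.le]; field_simp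
  unfold qq
  rw [hn, ← qq_eq (by positivity)]
  have hz : ‖z‖ ^ 2 = z 0 ^ 2 + z 1 ^ 2 + z 2 ^ 2 := by
    rw [EuclideanSpace.norm_sq_eq]; simp [Fin.sum_univ_three]
  simp only [dBf, Fin.sum_univ_three, if_true]
  have h2 : (‖z‖ / ε) ^ 2 = (ε ^ 2)⁻¹ * (z 0 ^ 2 + z 1 ^ 2 + z 2 ^ 2) := by
    rw [← hz]; field_simp
  generalize hp : phi ((‖z‖ / ε) ^ 2) = p
  generalize hp : dphi ((‖z‖ / ε) ^ 2) = p'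
  rw [h2]
  ring

lemma dBf_symm (ε : ℝ) (i j : Fin 3) (z : E3) : dBf ε i j z = dBf ε j i z := by
  unfold dBf
  by_cases h : i = j
  · simp [h]
  · rw [if_neg h, if_neg (Ne.symm h)]; ring

/-- basis vectors -/
def bv (i : Fin 3) : E3 := EuclideanSpace.single i 1

lemma norm_bv (i : Fin 3) : ‖bv i‖ = 1 := by simp [bv]

lemma Bf_hasDeriv (ε : ℝ) (i j : Fin 3) (z : E3) :
    HasDerivAt (fun t : ℝ => Bf ε j (z + t • bv i)) (dBf ε i j z) 0 := by
  have hc : ∀ k : Fin 3, HasDerivAt (fun t : ℝ => (z + t • bv i) k) (if i = k then 1 else 0) 0 := by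
    intro k
    have h1 : (fun t : ℝ => (z + t • bv i) k) = fun t => z k + t * (if i = k then 1 else 0) := by
      ext t; simp [bv, Pi.single_apply, eq_comm]
    rw [h1]
    simpa using ((hasDerivAt_id (0:ℝ)).mul_const (if i = k then (1:ℝ) else 0)).const_add (z k)
  have hs : ∀ t : ℝ, ‖z + t • bv i‖ ^ 2 = ‖z‖ ^ 2 + 2 * t * z i + t ^ 2 := by
    intro t
    rw [norm_add_sq_real, norm_smul, norm_bv, inner_smul_right]
    simp [bv, EuclideanSpace.inner_single_right]
    ring
  have hn : HasDerivAt (fun t : ℝ => (‖z + t • bv i‖ / ε) ^ 2) (2 * (ε ^ 2)⁻¹ * z i) 0 := by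
    have h1 : (fun t : ℝ => (‖z + t • bv i‖ / ε) ^ 2)
        = fun t => (‖z‖ ^ 2 + 2 * t * z i + t ^ 2) / ε ^ 2 := by
      ext t; rw [div_pow, hs]
    rw [h1]
    have h2 : HasDerivAt (fun t : ℝ => ‖z‖ ^ 2 + 2 * t * z i + t ^ 2) (2 * z i) 0 := by
      have a := (((hasDerivAt_id (0:ℝ)).const_mul 2).mul_const (z i)).const_add (‖z‖ ^ 2)
      have b : HasDerivAt (fun t : ℝ => ‖z‖ ^ 2 + 2 * t * z i + t ^ 2) _ 0 :=
        a.add (hasDerivAt_pow 2 (0:ℝ))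
      exact b.congr_deriv (by simp)
    have := h2.div_const (ε ^ 2)
    exact this.congr_deriv (by rw [div_eq_mul_inv]; ring)
  have hp : HasDerivAt (fun t : ℝ => phi ((‖z + t • bv i‖ / ε) ^ 2))
      (dphi ((‖z‖ / ε) ^ 2) * (2 * (ε ^ 2)⁻¹ * z i)) 0 :=
    HasDerivAt.comp_of_eq 0 (hasDerivAt_phi ((‖z‖ / ε) ^ 2)) hn (by simp)
  have := (hp.const_mul ((ε ^ 3)⁻¹)).mul (hc j)
  unfold Bf
  refine this.congr_deriv ?_
  simp only [zero_smul, add_zero, dBf]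
  split_ifs <;> ring



/-! ### Part 5: integration by parts for the regularised stress tensor -/

def DD (v : Fin 3 → E3 → ℝ) (i j : Fin 3) (z : E3) : ℝ := lineDeriv ℝ (v j) z (bv i)

def EE (v : Fin 3 → E3 → ℝ) (i j : Fin 3) (z : E3) : ℝ :=
  DD v i j z + DD v j i z - if i = j then ∑ k, DD v k k z else 0

lemma measurable_DD {v : Fin 3 → E3 → ℝ} {K : ℝ≥0} (hv : ∀ j, LipschitzWith K (v j)) (i j : Fin 3) :
    Measurable (DD v i j) := measurable_lineDeriv (hv j).continuous

lemma DD_le {v : Fin 3 → E3 → ℝ} {K : ℝ≥0} (hv : ∀ j, LipschitzWith K (v j)) (i j : Fin 3) (z : E3) :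
    |DD v i j z| ≤ K := by
  have := norm_lineDeriv_le_of_lipschitz ℝ (hv j) (x₀ := z) (v := bv i)
  rwa [norm_bv, mul_one] at this

lemma measurable_EE {v : Fin 3 → E3 → ℝ} {K : ℝ≥0} (hv : ∀ j, LipschitzWith K (v j)) (i j : Fin 3) :
    Measurable (EE v i j) := by
  have h := measurable_DD hv
  unfold EE
  split_ifs
  · exact ((h i j).add (h j i)).sub (Finset.measurable_sum _ fun k _ => h k k)
  · exact ((h i j).add (h j i)).sub measurable_const

lemma EE_le {v : Fin 3 → E3 → ℝ} {K : ℝ≥0} (hv : ∀ j, LipschitzWith K (v j)) (i j : Fin 3) (z : E3) :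
    |EE v i j z| ≤ 5 * K := by
  have h := fun i j => abs_le.1 (DD_le hv i j z)
  have hK : (0:ℝ) ≤ K := K.2
  unfold EE
  rw [abs_le, Fin.sum_univ_three]
  split_ifs <;> constructor <;>
    linarith [(h i j).1, (h i j).2, (h j i).1, (h j i).2, (h 0 0).1, (h 0 0).2, (h 1 1).1,
      (h 1 1).2, (h 2 2).1, (h 2 2).2]

def TT (ε : ℝ) (x y : E3) (i j : Fin 3) (z : E3) : ℝ :=
  Bf ε i (z - x) * Bf ε j (z - y) + Bf ε j (z - x) * Bf ε i (z - y)
    - if i = j then ∑ k, Bf ε k (z - x) * Bf ε k (z - y) else 0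

def dTT (ε : ℝ) (x y : E3) (i j : Fin 3) (z : E3) : ℝ :=
  (dBf ε i i (z - x) * Bf ε j (z - y) + Bf ε i (z - x) * dBf ε i j (z - y))
    + (dBf ε i j (z - x) * Bf ε i (z - y) + Bf ε j (z - x) * dBf ε i i (z - y))
    - if i = j then ∑ k, (dBf ε i k (z - x) * Bf ε k (z - y) + Bf ε k (z - x) * dBf ε i k (z - y))
      else 0

lemma dTT_div {ε : ℝ} (x y : E3) (j : Fin 3) (z : E3) :
    ∑ i, dTT ε x y i j z = (∑ i, dBf ε i i (z - x)) * Bf ε j (z - y)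
      + (∑ i, dBf ε i i (z - y)) * Bf ε j (z - x) := by
  have s1 := dBf_symm ε 0 1
  have s2 := dBf_symm ε 0 2
  have s3 := dBf_symm ε 1 2
  simp only [dTT, Fin.sum_univ_three]
  fin_cases j <;> simp [s1, s2, s3] <;> ring

lemma EE_TT (v : Fin 3 → E3 → ℝ) (ε : ℝ) (x y z : E3) :
    ∑ i, ∑ j, EE v i j z * (Bf ε i (z - x) * Bf ε j (z - y)) = ∑ j, ∑ i, DD v i j z * TT ε x y i j z := by
  simp [EE, TT, Fin.sum_univ_three]
  ring

lemma bracket_shift (x z : E3) : (1 + ‖z - x‖)⁻¹ ≤ (1 + ‖x‖) * (1 + ‖z‖)⁻¹ := by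
  rw [← div_eq_mul_inv, le_div_iff₀ (by positivity), inv_mul_le_iff₀ (by positivity)]
  have := norm_add_le (z - x) x
  rw [sub_add_cancel] at this
  nlinarith [norm_nonneg (z - x), norm_nonneg x]

lemma decay_mul {α β : E3 → ℝ} {A : ℝ} (hα : ∀ z, |α z| ≤ A * ((1 + ‖z‖) ^ 2)⁻¹)
    (hβ : ∀ z, |β z| ≤ A * ((1 + ‖z‖) ^ 2)⁻¹) (x y z : E3) :
    |α (z - x) * β (z - y)| ≤ (A ^ 2 * (1 + ‖x‖) ^ 2 * (1 + ‖y‖) ^ 2) * ((1 + ‖z‖) ^ 4)⁻¹ := by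
  have hA : 0 ≤ A := by
    have := (abs_nonneg _).trans (hα 0); simpa using this
  rw [abs_mul]
  calc |α (z - x)| * |β (z - y)|
      ≤ (A * ((1 + ‖x‖) * (1 + ‖z‖)⁻¹) ^ 2) * (A * ((1 + ‖y‖) * (1 + ‖z‖)⁻¹) ^ 2) := by
        refine mul_le_mul ((hα _).trans ?_) ((hβ _).trans ?_) (abs_nonneg _) (by positivity)
        · rw [← inv_pow]
          have := bracket_shift x z
          gcongr
        · rw [← inv_pow]
          have := bracket_shift y z
          gcongr
    _ = _ := by
        rw [← inv_pow]; ring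

/-- the decay constant -/
def CT (ε : ℝ) (x y : E3) : ℝ := (22 * (ε ^ 3)⁻¹) ^ 2 * (1 + ‖x‖) ^ 2 * (1 + ‖y‖) ^ 2

lemma CT_nonneg (ε : ℝ) (x y : E3) : 0 ≤ CT ε x y := by unfold CT; positivity

lemma TT_decay {ε : ℝ} (hε : 0 < ε) (hε1 : ε ≤ 1) (x y : E3) (i j : Fin 3) (z : E3) :
    |TT ε x y i j z| ≤ (10 * CT ε x y) * ((1 + ‖z‖) ^ 4)⁻¹ := by
  have h : ∀ k l, |Bf ε k (z - x) * Bf ε l (z - y)| ≤ CT ε x y * ((1 + ‖z‖) ^ 4)⁻¹ := fun k l =>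
    decay_mul (Bf_decay hε hε1 k) (Bf_decay hε hε1 l) x y z
  have h' := fun i j => abs_le.1 (h i j)
  have h0 := (abs_nonneg _).trans (h 0 0)
  unfold TT
  rw [abs_le, Fin.sum_univ_three]
  split_ifs <;> constructor <;>
    linarith [(h' i j).1, (h' i j).2, (h' j i).1, (h' j i).2, (h' 0 0).1, (h' 0 0).2, (h' 1 1).1,
      (h' 1 1).2, (h' 2 2).1, (h' 2 2).2]

lemma dTT_decay {ε : ℝ} (hε : 0 < ε) (hε1 : ε ≤ 1) (x y : E3) (i j : Fin 3) (z : E3) :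
    |dTT ε x y i j z| ≤ (10 * CT ε x y) * ((1 + ‖z‖) ^ 4)⁻¹ := by
  have h1 : ∀ k l m, |dBf ε k l (z - x) * Bf ε m (z - y)| ≤ CT ε x y * ((1 + ‖z‖) ^ 4)⁻¹ :=
    fun k l m => decay_mul (dBf_decay hε hε1 k l) (Bf_decay hε hε1 m) x y z
  have h2 : ∀ k l m, |Bf ε m (z - x) * dBf ε k l (z - y)| ≤ CT ε x y * ((1 + ‖z‖) ^ 4)⁻¹ :=
    fun k l m => decay_mul (Bf_decay hε hε1 m) (dBf_decay hε hε1 k l) x y z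
  have a := fun k l m => abs_le.1 (h1 k l m)
  have b := fun k l m => abs_le.1 (h2 k l m)
  have h0 := (abs_nonneg _).trans (h1 0 0 0)
  unfold dTT
  rw [abs_le, Fin.sum_univ_three]
  split_ifs <;> constructor <;>
    linarith [(a i i j).1, (a i i j).2, (a i j i).1, (a i j i).2, (b i j i).1, (b i j i).2,
      (b i i j).1, (b i i j).2, (a i 0 0).1, (a i 0 0).2, (a i 1 1).1, (a i 1 1).2, (a i 2 2).1,
      (a i 2 2).2, (b i 0 0).1, (b i 0 0).2, (b i 1 1).1, (b i 1 1).2, (b i 2 2).1, (b i 2 2).2]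

lemma measurable_TT (ε : ℝ) (x y : E3) (i j : Fin 3) : Measurable (TT ε x y i j) := by
  have h1 := fun k => meas_shift (measurable_Bf ε k) x
  have h2 := fun k => meas_shift (measurable_Bf ε k) y
  unfold TT
  split_ifs
  · exact (((h1 i).mul (h2 j)).add ((h1 j).mul (h2 i))).sub
      (Finset.measurable_sum _ fun k _ => (h1 k).mul (h2 k))
  · exact (((h1 i).mul (h2 j)).add ((h1 j).mul (h2 i))).sub measurable_const

lemma measurable_dTT (ε : ℝ) (x y : E3) (i j : Fin 3) : Measurable (dTT ε x y i j) := by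
  have h1 := fun k => meas_shift (measurable_Bf ε k) x
  have h2 := fun k => meas_shift (measurable_Bf ε k) y
  have d1 := fun k l => meas_shift (measurable_dBf ε k l) x
  have d2 := fun k l => meas_shift (measurable_dBf ε k l) y
  unfold dTT
  split_ifs
  · exact ((((d1 _ _).mul (h2 _)).add ((h1 _).mul (d2 _ _))).add
      (((d1 _ _).mul (h2 _)).add ((h1 _).mul (d2 _ _)))).sub
      (Finset.measurable_sum _ fun k _ => ((d1 _ _).mul (h2 _)).add ((h1 _).mul (d2 _ _)))
  · exact ((((d1 _ _).mul (h2 _)).add ((h1 _).mul (d2 _ _))).add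
      (((d1 _ _).mul (h2 _)).add ((h1 _).mul (d2 _ _)))).sub measurable_const

lemma TT_hasDeriv (ε : ℝ) (x y : E3) (i j : Fin 3) (z : E3) :
    HasDerivAt (fun t : ℝ => TT ε x y i j (z + t • bv i)) (dTT ε x y i j z) 0 := by
  have h : ∀ (x : E3) (k : Fin 3), HasDerivAt (fun t : ℝ => Bf ε k (z + t • bv i - x))
      (dBf ε i k (z - x)) 0 := by
    intro x k
    have := Bf_hasDeriv ε i k (z - x)
    refine this.congr_of_eventuallyEq (Eventually.of_forall fun t => ?_)
    simp only
    rw [sub_add_eq_add_sub]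
  have h2 : ∀ k l : Fin 3, HasDerivAt
      (fun t : ℝ => Bf ε k (z + t • bv i - x) * Bf ε l (z + t • bv i - y))
      (dBf ε i k (z - x) * Bf ε l (z - y) + Bf ε k (z - x) * dBf ε i l (z - y)) 0 := by
    intro k l
    have := (h x k).mul (h y l)
    exact this.congr_deriv (by simp only [zero_smul, add_zero])
  unfold TT dTT
  split_ifs
  · exact ((h2 i j).add (h2 j i)).sub (HasDerivAt.fun_sum fun k _ => h2 k k)
  · exact ((h2 i j).add (h2 j i)).sub (hasDerivAt_const _ _)

lemma integrable_mul_decay {m g : E3 → ℝ} {b C : ℝ} (hm : Measurable m) (hg : Measurable g)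
    (bm : ∀ z, |m z| ≤ b) (bg : ∀ z, |g z| ≤ C * ((1 + ‖z‖) ^ 4)⁻¹) :
    Integrable (fun z => m z * g z) := by
  refine Integrable.mono' ((integrable_bracket.const_mul (b * C)))
    (hm.mul hg).aestronglyMeasurable (Eventually.of_forall fun z => ?_)
  rw [Real.norm_eq_abs, abs_mul, mul_assoc]
  exact mul_le_mul (bm z) (bg z) (abs_nonneg _) ((abs_nonneg _).trans (bm z))

lemma stress_eps {v : Fin 3 → E3 → ℝ} {K : ℝ≥0} {b : ℝ} (hv : ∀ j, LipschitzWith K (v j))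
    (hb : ∀ j z, |v j z| ≤ b) {ε : ℝ} (hε : 0 < ε) (hε1 : ε ≤ 1) (x y : E3) :
    ∫ z, ∑ i, ∑ j, EE v i j z * (Bf ε i (z - x) * Bf ε j (z - y))
     = - ((∫ z, (∑ i, dBf ε i i (z - x)) * ∑ j, v j z * Bf ε j (z - y))
        + ∫ z, (∑ i, dBf ε i i (z - y)) * ∑ j, v j z * Bf ε j (z - x)) := by
  simp_rw [EE_TT]
  have I1 : ∀ i j, Integrable (fun z => DD v i j z * TT ε x y i j z) := fun i j =>
    integrable_mul_decay (measurable_DD hv i j) (measurable_TT ε x y i j) (DD_le hv i j)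
      (TT_decay hε hε1 x y i j)
  have I2 : ∀ i j, Integrable (fun z => v j z * dTT ε x y i j z) := fun i j =>
    integrable_mul_decay (hv j).continuous.measurable (measurable_dTT ε x y i j) (hb j)
      (dTT_decay hε hε1 x y i j)
  have I3 : ∀ x y, Integrable (fun z => (∑ i, dBf ε i i (z - x)) * ∑ j, v j z * Bf ε j (z - y)) := by
    intro x y
    have : ∀ i j, Integrable (fun z => v j z * (dBf ε i i (z - x) * Bf ε j (z - y))) := fun i j =>
      integrable_mul_decay (hv j).continuous.measurable
        ((meas_shift (measurable_dBf ε i i) x).mul (meas_shift (measurable_Bf ε j) y)) (hb j)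
        (decay_mul (dBf_decay hε hε1 i i) (Bf_decay hε hε1 j) x y)
    have h := integrable_finsetSum Finset.univ fun i _ =>
      integrable_finsetSum Finset.univ fun j _ => this i j
    refine h.congr (Eventually.of_forall fun z => ?_)
    simp only [Finset.sum_mul_sum]
    refine Finset.sum_congr rfl fun i _ => ?_
    refine Finset.sum_congr rfl fun j _ => ?_
    ring
  rw [← integral_add (I3 x y) (I3 y x),
    integral_finsetSum _ fun j _ => integrable_finsetSum _ fun i _ => I1 i j]
  simp_rw [fun j => integral_finsetSum Finset.univ fun i _ => I1 i j]
  have key : ∀ i j, ∫ z, DD v i j z * TT ε x y i j z = - ∫ z, v j z * dTT ε x y i j z := fun i j =>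
    ibp (norm_bv i) (hv j) (hb j) (measurable_TT ε x y i j) (measurable_dTT ε x y i j)
      (TT_hasDeriv ε x y i j) (TT_decay hε hε1 x y i j) (dTT_decay hε hε1 x y i j)
  simp_rw [key, Finset.sum_neg_distrib]
  congr 1
  simp_rw [fun j => (integral_finsetSum Finset.univ fun i _ => I2 i j).symm]
  rw [← integral_finsetSum _ fun j _ => integrable_finsetSum _ fun i _ => I2 i j]
  congr 1
  ext z
  simp_rw [← Finset.mul_sum, dTT_div]
  rw [Finset.mul_sum, Finset.mul_sum, ← Finset.sum_add_distrib]
  refine Finset.sum_congr rfl fun j _ => ?_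
  ring


/-! ### Part 6: the limit of vanishing regularisation -/

lemma measurable_qq : Measurable qq := by
  unfold qq
  exact Measurable.ite (measurableSet_lt measurable_norm measurable_const) (by fun_prop)
    measurable_const

lemma qq_nonneg (w : E3) : 0 ≤ qq w := by
  unfold qq; split_ifs with h
  · have := norm_nonneg w
    nlinarith
  · exact le_rfl

lemma qq_le (w : E3) : qq w ≤ (Metric.ball (0:E3) 1).indicator (fun _ => 15/2) w := by
  unfold qq
  by_cases h : ‖w‖ < 1
  · rw [if_pos h, indicator_of_mem (by simpa using h)]
    nlinarith [sq_nonneg ‖w‖]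
  · rw [if_neg h, indicator_of_notMem (by simpa using h)]

lemma integrable_qq : Integrable qq := by
  have h : Integrable ((Metric.ball (0:E3) 1).indicator (fun _ => (15/2:ℝ))) :=
    (integrableOn_const (by exact measure_ball_lt_top.ne)).integrable_indicator
      measurableSet_ball
  refine h.mono' measurable_qq.aestronglyMeasurable (Eventually.of_forall fun w => ?_)
  rw [Real.norm_of_nonneg (qq_nonneg w)]
  exact qq_le w

def cq : ℝ := ∫ w, qq w

lemma cq_pos : 0 < cq := by
  unfold cq
  rw [integral_pos_iff_support_of_nonneg qq_nonneg integrable_qq]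
  have : Metric.ball (0:E3) 1 ⊆ Function.support qq := by
    intro w hw
    have hw : ‖w‖ < 1 := by simpa using hw
    simp only [Function.mem_support, qq, if_pos hw]
    have := norm_nonneg w
    have : 0 < 1 - ‖w‖ ^ 2 := by nlinarith
    positivity
  exact (Metric.measure_ball_pos volume 0 one_pos).trans_le (measure_mono this)

lemma source_limit {F : ℝ → E3 → ℝ} {x : E3} {l C ε0 : ℝ} (h0 : 0 < ε0)
    (hF : ∀ ε, Measurable (F ε))
    (hb : ∀ ε, 0 < ε → ε < ε0 → ∀ w : E3, ‖w‖ < 1 → |F ε (x + ε • w)| ≤ C)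
    (hl : ∀ w : E3, ‖w‖ < 1 → Tendsto (fun ε => F ε (x + ε • w)) (𝓝[>] 0) (𝓝 l)) :
    Tendsto (fun ε => ∫ z, ((ε ^ 3)⁻¹ * qq (ε⁻¹ • (z - x))) * F ε z) (𝓝[>] 0) (𝓝 (cq * l)) := by
  have e1 : ∀ᶠ ε in 𝓝[>] (0:ℝ), ∫ w, qq w * F ε (x + ε • w)
      = ∫ z, ((ε ^ 3)⁻¹ * qq (ε⁻¹ • (z - x))) * F ε z := by
    filter_upwards [self_mem_nhdsWithin] with ε hε
    have hε : 0 < ε := hε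
    rw [← integral_add_right_eq_self (fun z => ((ε ^ 3)⁻¹ * qq (ε⁻¹ • (z - x))) * F ε z) x]
    have := Measure.integral_comp_inv_smul (volume : Measure E3) (fun w => qq w * F ε (x + ε • w)) ε
    rw [finrank_E3, abs_of_pos (by positivity)] at this
    simp only [add_sub_cancel_right, mul_assoc]
    rw [integral_const_mul]
    simp only [smul_inv_smul₀ hε.ne'] at this
    simp only [add_comm _ x, this]
    rw [smul_eq_mul, inv_mul_cancel_left₀ (by positivity)]
  refine Tendsto.congr' e1 ?_
  unfold cq
  rw [← integral_mul_const]
  refine tendsto_integral_filter_of_dominated_convergence (fun w => qq w * C) ?_ ?_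
    (integrable_qq.mul_const C) ?_
  · refine Eventually.of_forall fun ε => ?_
    refine (measurable_qq.mul ((hF ε).comp ?_)).aestronglyMeasurable
    fun_prop
  · filter_upwards [Ioo_mem_nhdsGT h0] with ε hε
    refine Eventually.of_forall fun w => ?_
    rw [norm_mul, Real.norm_of_nonneg (qq_nonneg w), Real.norm_eq_abs]
    by_cases hw : ‖w‖ < 1
    · exact mul_le_mul_of_nonneg_left (hb ε hε.1 hε.2 w hw) (qq_nonneg w)
    · simp [qq, hw]
  · refine Eventually.of_forall fun w => ?_
    by_cases hw : ‖w‖ < 1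
    · exact (hl w hw).const_mul _
    · simp [qq, hw]

lemma f0_shift_le {x y : E3} {a : E3} (ha : ‖a‖ ≤ ‖x - y‖ / 2) :
    ‖x - y‖ / 2 ≤ ‖x + a - y‖ := by
  have : x - y = (x + a - y) - a := by abel
  have h2 := norm_sub_le (x + a - y) a
  rw [← this] at h2
  linarith

lemma source_side {v : Fin 3 → E3 → ℝ} {K : ℝ≥0} {b : ℝ} (hv : ∀ j, LipschitzWith K (v j))
    (hb : ∀ j z, |v j z| ≤ b) {x y : E3} (h : x ≠ y) :
    Tendsto (fun ε => ∫ z, (∑ i, dBf ε i i (z - x)) * ∑ j, v j z * Bf ε j (z - y)) (𝓝[>] 0)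
      (𝓝 (cq * ∑ j, v j x * Af j (x - y))) := by
  set r := ‖x - y‖ with hr
  have hr0 : 0 < r := norm_pos_iff.2 (sub_ne_zero.2 h)
  have key := source_limit (F := fun ε z => ∑ j, v j z * Bf ε j (z - y)) (x := x)
    (l := ∑ j, v j x * Af j (x - y)) (C := 3 * (b * (5 / 2 * ((r / 2) ^ 2)⁻¹))) (ε0 := r / 2)
    (by positivity) ?_ ?_ ?_
  · refine Tendsto.congr' ?_ key
    filter_upwards [self_mem_nhdsWithin] with ε hε
    simp only [dBf_div (show 0 < ε from hε)]
  · intro ε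
    exact Finset.measurable_sum _ fun j _ => (hv j).continuous.measurable.mul
      (meas_shift (measurable_Bf ε j) y)
  · intro ε hε hε0 w hw
    have hn : r / 2 ≤ ‖x + ε • w - y‖ := by
      refine f0_shift_le ?_
      rw [norm_smul, Real.norm_of_nonneg hε.le]
      nlinarith [norm_nonneg w]
    refine (Finset.abs_sum_le_sum_abs _ _).trans ?_
    have : ∀ j ∈ Finset.univ, |v j (x + ε • w) * Bf ε j (x + ε • w - y)|
        ≤ b * (5 / 2 * ((r / 2) ^ 2)⁻¹) := by
      intro j _
      rw [abs_mul]
      refine mul_le_mul (hb j _) ((Bf_le hε j _).trans ?_) (abs_nonneg _)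
        ((abs_nonneg _).trans (hb j x))
      unfold f0
      gcongr
    have := Finset.sum_le_card_nsmul _ _ _ this
    simpa using this
  · intro w hw
    have hc : Tendsto (fun ε : ℝ => x + ε • w) (𝓝[>] 0) (𝓝 x) := by
      have : Continuous (fun ε : ℝ => x + ε • w) := by fun_prop
      have := this.tendsto 0
      simp only [zero_smul, add_zero] at this
      exact this.mono_left nhdsWithin_le_nhds
    refine tendsto_finsetSum _ fun j _ => ?_
    refine (((hv j).continuous.tendsto x).comp hc).mul ?_
    have hA : ContinuousAt (Af j) (x - y) := by
      unfold Af
      refine ContinuousAt.mul ?_ (by fun_prop)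
      refine ContinuousAt.inv₀ (by fun_prop) ?_
      rw [← hr]; positivity
    have h2 : Tendsto (fun ε : ℝ => Af j (x + ε • w - y)) (𝓝[>] 0) (𝓝 (Af j (x - y))) :=
      hA.tendsto.comp (hc.sub_const y)
    refine h2.congr' ?_
    filter_upwards [Ioo_mem_nhdsGT (half_pos hr0)] with ε hε
    rw [Bf_eq_Af hε.1]
    refine hε.2.trans_le (f0_shift_le ?_)
    rw [norm_smul, Real.norm_of_nonneg hε.1.le]
    nlinarith [norm_nonneg w, hε.1, hε.2]

lemma stress_side {v : Fin 3 → E3 → ℝ} {K : ℝ≥0} (hv : ∀ j, LipschitzWith K (v j))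
    {x y : E3} (h : x ≠ y) :
    Tendsto (fun ε => ∫ z, ∑ i, ∑ j, EE v i j z * (Bf ε i (z - x) * Bf ε j (z - y))) (𝓝[>] 0)
      (𝓝 (∫ z, ∑ i, ∑ j, EE v i j z * (Af i (z - x) * Af j (z - y)))) := by
  refine tendsto_integral_filter_of_dominated_convergence
    (fun z => ∑ _i : Fin 3, ∑ _j : Fin 3, (5 * K) * (25 / 4) * (f0 (z - x) * f0 (z - y))) ?_ ?_ ?_ ?_
  · refine Eventually.of_forall fun ε => ?_
    refine (Finset.measurable_sum _ fun i _ => Finset.measurable_sum _ fun j _ =>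
      (measurable_EE hv i j).mul ((meas_shift (measurable_Bf ε i) x).mul
        (meas_shift (measurable_Bf ε j) y))).aestronglyMeasurable
  · filter_upwards [self_mem_nhdsWithin] with ε hε
    refine Eventually.of_forall fun z => ?_
    have hε : 0 < ε := hε
    refine (norm_sum_le _ _).trans (Finset.sum_le_sum fun i _ => ?_)
    refine (norm_sum_le _ _).trans (Finset.sum_le_sum fun j _ => ?_)
    rw [Real.norm_eq_abs, abs_mul, abs_mul]
    have h1 := EE_le hv i j z
    have h2 := Bf_le hε i (z - x)
    have h3 := Bf_le hε j (z - y)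
    have := f0_nonneg (z - x)
    have := f0_nonneg (z - y)
    calc _ ≤ (5 * K) * ((5 / 2 * f0 (z - x)) * (5 / 2 * f0 (z - y))) := by gcongr
      _ = _ := by ring
  · exact integrable_finsetSum _ fun i _ => integrable_finsetSum _ fun j _ =>
      (integrable_f0f0 h).const_mul _
  · have a1 : ∀ᵐ z : E3, z ≠ x := by simp [ae_iff, measure_singleton]
    have a2 : ∀ᵐ z : E3, z ≠ y := by simp [ae_iff, measure_singleton]
    filter_upwards [a1, a2] with z h1 h2
    have n1 : 0 < ‖z - x‖ := norm_pos_iff.2 (sub_ne_zero.2 h1)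
    have n2 : 0 < ‖z - y‖ := norm_pos_iff.2 (sub_ne_zero.2 h2)
    refine Tendsto.congr' ?_ tendsto_const_nhds
    filter_upwards [Ioo_mem_nhdsGT n1, Ioo_mem_nhdsGT n2] with ε b1 b2
    refine Finset.sum_congr rfl fun i _ => Finset.sum_congr rfl fun j _ => ?_
    rw [Bf_eq_Af b1.1 i b1.2, Bf_eq_Af b2.1 j b2.2]

lemma lemmaA {v : Fin 3 → E3 → ℝ} {K : ℝ≥0} {b : ℝ} (hv : ∀ j, LipschitzWith K (v j))
    (hb : ∀ j z, |v j z| ≤ b) {x y : E3} (h : x ≠ y) :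
    ∫ z, ∑ i, ∑ j, EE v i j z * (Af i (z - x) * Af j (z - y))
      = - cq * ((∑ j, (v j x - v j y) * (x j - y j)) / ‖x - y‖ ^ 3) := by
  have t1 := stress_side hv h
  have t2 := ((source_side hv hb h).add (source_side hv hb h.symm)).neg
  have := tendsto_nhds_unique_of_eventuallyEq t1 t2 (by
    filter_upwards [Ioo_mem_nhdsGT one_pos] with ε hε
    exact stress_eps hv hb hε.1 hε.2.le x y)
  rw [this]
  simp only [Af, Fin.sum_univ_three, PiLp.sub_apply]
  rw [norm_sub_rev y x]
  ring

lemma lemmaA_PP {v : Fin 3 → E3 → ℝ} {K : ℝ≥0} {b : ℝ} (hv : ∀ j, LipschitzWith K (v j))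
    (hb : ∀ j z, |v j z| ≤ b) {x y : E3} (h : x ≠ y) :
    ∑ i, ∑ j, PP (EE v i j) (Af i) (Af j) x y
      = - cq * ((∑ j, (v j x - v j y) * (x j - y j)) / ‖x - y‖ ^ 3) := by
  rw [← lemmaA hv hb h]
  have I : ∀ i j, Integrable (fun z => EE v i j z * (Af i (z - x) * Af j (z - y))) := fun i j =>
    PP_integrable (measurable_EE hv i j) (measurable_Af i) (measurable_Af j) (EE_le hv i j)
      (Af_le i) (Af_le j) h
  rw [integral_finsetSum _ fun i _ => integrable_finsetSum _ fun j _ => I i j]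
  refine Finset.sum_congr rfl fun i _ => ?_
  rw [integral_finsetSum _ fun j _ => I i j]
  rfl


/-! ### Part 7: the Coulomb potential as a quadratic expression -/

def clampv (R : ℝ) (j : Fin 3) (z : E3) : ℝ := max (-R) (min R (z j))

lemma clampv_lip (R : ℝ) (j : Fin 3) : LipschitzWith 1 (clampv R j) := by
  have h : LipschitzWith 1 (fun z : E3 => z j) := by
    refine LipschitzWith.of_dist_le_mul fun a b => ?_
    rw [Real.dist_eq, dist_eq_norm]
    simpa using abs_coord_le (a - b) j
  exact (h.const_min R).const_max (-R)

lemma clampv_le {R : ℝ} (hR : 0 ≤ R) (j : Fin 3) (z : E3) : |clampv R j z| ≤ R := by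
  unfold clampv
  rw [abs_le]
  exact ⟨le_max_left _ _, max_le (by linarith) (min_le_left _ _)⟩

lemma clampv_eq {R : ℝ} (j : Fin 3) {z : E3} (h : ‖z‖ < R) : clampv R j z = z j := by
  have := abs_le.1 (abs_coord_le z j)
  unfold clampv
  rw [min_eq_right (by linarith), max_eq_right (by linarith)]

lemma DD_clampv {R : ℝ} (i j : Fin 3) {z : E3} (h : ‖z‖ < R) :
    DD (clampv R) i j z = if i = j then 1 else 0 := by
  unfold DD
  have h1 : HasLineDerivAt ℝ (fun z : E3 => z j) (if i = j then 1 else 0) z (bv i) := by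
    unfold HasLineDerivAt
    have h1 : (fun t : ℝ => (z + t • bv i) j) = fun t => z j + t * (if i = j then 1 else 0) := by
      ext t; simp [bv, eq_comm]
    rw [h1]
    simpa using ((hasDerivAt_id (0:ℝ)).mul_const (if i = j then (1:ℝ) else 0)).const_add (z j)
  have h2 : HasLineDerivAt ℝ (clampv R j) (if i = j then 1 else 0) z (bv i) := by
    refine h1.congr_of_eventuallyEq ?_
    have : ∀ᶠ w in 𝓝 z, ‖w‖ < R := continuous_norm.continuousAt.eventually_lt_const h
    filter_upwards [this] with w hw
    exact clampv_eq j hw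
  exact h2.lineDeriv

lemma EE_clampv {R : ℝ} (i j : Fin 3) {z : E3} (h : ‖z‖ < R) :
    EE (clampv R) i j z = if i = j then -1 else 0 := by
  unfold EE
  simp only [DD_clampv _ _ h]
  by_cases hij : i = j
  · simp [hij]; norm_num
  · simp [hij, Ne.symm hij]

lemma V_identity {x y : E3} (h : x ≠ y) :
    ∑ j, PP (fun _ => 1) (Af j) (Af j) x y = cq / ‖x - y‖ := by
  have hr0 : 0 < ‖x - y‖ := norm_pos_iff.2 (sub_ne_zero.2 h)
  have hL : ∀ R : ℝ, ∀ j, LipschitzWith 1 (clampv R j) := clampv_lip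
  have t1 : Tendsto (fun R : ℝ => ∫ z, ∑ i, ∑ j, EE (clampv R) i j z * (Af i (z - x) * Af j (z - y)))
      atTop (𝓝 (∫ z, - ∑ j, Af j (z - x) * Af j (z - y))) := by
    refine tendsto_integral_filter_of_dominated_convergence
      (fun z => ∑ _i : Fin 3, ∑ _j : Fin 3, 5 * (f0 (z - x) * f0 (z - y))) ?_ ?_ ?_ ?_
    · refine Eventually.of_forall fun R => ?_
      refine (Finset.measurable_sum _ fun i _ => Finset.measurable_sum _ fun j _ =>
        (measurable_EE (hL R) i j).mul ((meas_shift (measurable_Af i) x).mul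
          (meas_shift (measurable_Af j) y))).aestronglyMeasurable
    · refine Eventually.of_forall fun R => Eventually.of_forall fun z => ?_
      refine (norm_sum_le _ _).trans (Finset.sum_le_sum fun i _ => ?_)
      refine (norm_sum_le _ _).trans (Finset.sum_le_sum fun j _ => ?_)
      rw [Real.norm_eq_abs, abs_mul, abs_mul]
      have h1 := EE_le (hL R) i j z
      simp only [NNReal.coe_one, mul_one] at h1
      have h2 := Af_le i (z - x)
      have h3 := Af_le j (z - y)
      have := f0_nonneg (z - x)
      gcongr
    · exact integrable_finsetSum _ fun i _ => integrable_finsetSum _ fun j _ =>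
        (integrable_f0f0 h).const_mul _
    · refine Eventually.of_forall fun z => ?_
      refine Tendsto.congr' ?_ tendsto_const_nhds
      filter_upwards [eventually_gt_atTop ‖z‖] with R hR
      simp [EE_clampv _ _ hR]
  have t2 : Tendsto (fun R : ℝ => ∫ z, ∑ i, ∑ j, EE (clampv R) i j z * (Af i (z - x) * Af j (z - y)))
      atTop (𝓝 (- cq / ‖x - y‖)) := by
    refine Tendsto.congr' ?_ tendsto_const_nhds
    filter_upwards [eventually_gt_atTop ‖x‖, eventually_gt_atTop ‖y‖] with R h1 h2
    rw [lemmaA (hL R) (fun j z => clampv_le ((norm_nonneg x).trans h1.le) j z) h]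
    simp only [clampv_eq _ h1, clampv_eq _ h2]
    have : ∑ j, (x j - y j) * (x j - y j) = ‖x - y‖ ^ 2 := by
      rw [EuclideanSpace.norm_sq_eq]; simp [Fin.sum_univ_three, sq]
    rw [this]
    field_simp
  have := tendsto_nhds_unique t1 t2
  rw [integral_neg, neg_div, neg_inj] at this
  rw [← this, integral_finsetSum]
  · simp [PP]
  · intro j _
    simpa using PP_integrable (m := fun _ => 1) (m0 := 1) measurable_const (measurable_Af j)
      (measurable_Af j) (by simp) (Af_le j) (Af_le j) h


/-! ### Part 8: full quadratic forms -/

def modFull (w : E3 × E3 → ℝ) (μ ν : Measure E3) : ℝ :=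
  ∫ p, w p ∂(μ.prod μ) - ∫ p, w p ∂(μ.prod ν) - ∫ p, w p ∂(ν.prod μ) + ∫ p, w p ∂(ν.prod ν)

lemma int4 {X : Type*} [MeasurableSpace X] {μ : Measure X} {a b c d : X → ℝ} (ha : Integrable a μ)
    (hb : Integrable b μ) (hc : Integrable c μ) (hd : Integrable d μ) :
    ∫ x, (a x - b x - c x + d x) ∂μ = ∫ x, a x ∂μ - ∫ x, b x ∂μ - ∫ x, c x ∂μ + ∫ x, d x ∂μ := by
  have h1 : Integrable (fun x => a x - b x) μ := ha.sub hb
  have h2 : Integrable (fun x => a x - b x - c x) μ := h1.sub hc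
  rw [integral_add h2 hd, integral_sub h1 hc, integral_sub ha hb]

/-- bounded product kernels -/
structure Ker (m α β : E3 → ℝ) (C : ℝ) : Prop where
  hm : Measurable m
  hα : Measurable α
  hβ : Measurable β
  int : ∀ x y, Integrable (fun z => m z * (α (z - x) * β (z - y)))
  bd : ∀ x y, ∫ z, ‖m z * (α (z - x) * β (z - y))‖ ≤ C

lemma Ker.abs_le {m α β : E3 → ℝ} {C : ℝ} (h : Ker m α β C) (x y : E3) : |PP m α β x y| ≤ C :=
  (norm_integral_le_integral_norm _).trans (h.bd x y)

lemma Ker.measurable {m α β : E3 → ℝ} {C : ℝ} (h : Ker m α β C) :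
    Measurable (fun p : E3 × E3 => PP m α β p.1 p.2) := PP_meas h.hm h.hα h.hβ

lemma bdd_integrable {μ : Measure (E3 × E3)} [IsFiniteMeasure μ] {w : E3 × E3 → ℝ} {C : ℝ}
    (hw : Measurable w) (hb : ∀ p, |w p| ≤ C) : Integrable w μ :=
  Integrable.mono' (integrable_const C) hw.aestronglyMeasurable (Eventually.of_forall hb)

lemma Ker.fubini {m α β : E3 → ℝ} {C : ℝ} (h : Ker m α β C) (μ1 ν1 : Measure E3)
    [IsFiniteMeasure μ1] [IsFiniteMeasure ν1] :
    Integrable (fun z => m z * ((∫ x, α (z - x) ∂μ1) * ∫ y, β (z - y) ∂ν1)) ∧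
    ∫ p, PP m α β p.1 p.2 ∂(μ1.prod ν1)
      = ∫ z, m z * ((∫ x, α (z - x) ∂μ1) * ∫ y, β (z - y) ∂ν1) := by
  have hmeas : StronglyMeasurable (fun q : (E3 × E3) × E3 =>
      m q.2 * (α (q.2 - q.1.1) * β (q.2 - q.1.2))) := by
    apply Measurable.stronglyMeasurable
    refine (h.hm.comp measurable_snd).mul ((h.hα.comp ?_).mul (h.hβ.comp ?_)) <;> fun_prop
  have I : Integrable (fun q : (E3 × E3) × E3 =>
      m q.2 * (α (q.2 - q.1.1) * β (q.2 - q.1.2))) ((μ1.prod ν1).prod volume) := by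
    rw [integrable_prod_iff hmeas.aestronglyMeasurable]
    refine ⟨Eventually.of_forall fun p => h.int p.1 p.2, ?_⟩
    refine Integrable.mono' (integrable_const C)
      hmeas.norm.integral_prod_right.aestronglyMeasurable (Eventually.of_forall fun p => ?_)
    rw [Real.norm_of_nonneg (integral_nonneg fun _ => norm_nonneg _)]
    exact h.bd p.1 p.2
  have e : ∀ z, ∫ p : E3 × E3, m z * (α (z - p.1) * β (z - p.2)) ∂(μ1.prod ν1)
      = m z * ((∫ x, α (z - x) ∂μ1) * ∫ y, β (z - y) ∂ν1) := by
    intro z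
    rw [integral_const_mul,
      integral_prod_mul (fun x => α (z - x)) (fun y => β (z - y))]
  constructor
  · have := I.integral_prod_right
    simpa only [e] using this
  · have := integral_integral_swap (f := fun (p : E3 × E3) z =>
      m z * (α (z - p.1) * β (z - p.2))) I
    simp only [e] at this
    exact this

def HH (α : E3 → ℝ) (μ ν : Measure E3) (z : E3) : ℝ := ∫ x, α (z - x) ∂μ - ∫ x, α (z - x) ∂ν

lemma Ker.modFull {m α β : E3 → ℝ} {C : ℝ} (h : Ker m α β C) (μ ν : Measure E3)
    [IsFiniteMeasure μ] [IsFiniteMeasure ν] :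
    Integrable (fun z => m z * (HH α μ ν z * HH β μ ν z)) ∧
    modFull (fun p => PP m α β p.1 p.2) μ ν = ∫ z, m z * (HH α μ ν z * HH β μ ν z) := by
  obtain ⟨i1, e1⟩ := h.fubini μ μ
  obtain ⟨i2, e2⟩ := h.fubini μ ν
  obtain ⟨i3, e3⟩ := h.fubini ν μ
  obtain ⟨i4, e4⟩ := h.fubini ν ν
  have e : (fun z => m z * (HH α μ ν z * HH β μ ν z)) = fun z =>
      m z * ((∫ x, α (z - x) ∂μ) * ∫ y, β (z - y) ∂μ)
      - m z * ((∫ x, α (z - x) ∂μ) * ∫ y, β (z - y) ∂ν)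
      - m z * ((∫ x, α (z - x) ∂ν) * ∫ y, β (z - y) ∂μ)
      + m z * ((∫ x, α (z - x) ∂ν) * ∫ y, β (z - y) ∂ν) := by
    ext z; unfold HH; ring
  rw [e]
  refine ⟨((i1.sub i2).sub i3).add i4, ?_⟩
  unfold _root_.modFull
  rw [e1, e2, e3, e4]
  exact (int4 i1 i2 i3 i4).symm

lemma Ker.sq_nonneg {α : E3 → ℝ} {C : ℝ} (h : Ker 1 α α C) (μ ν : Measure E3)
    [IsFiniteMeasure μ] [IsFiniteMeasure ν] :
    0 ≤ _root_.modFull (fun p => PP 1 α α p.1 p.2) μ ν := by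
  rw [(h.modFull μ ν).2]
  exact integral_nonneg fun z => by simpa using mul_self_nonneg _

lemma Ker.modFull_le {m α β : E3 → ℝ} {C C1 C2 m0 : ℝ} (h : Ker m α β C) (h1 : Ker 1 α α C1)
    (h2 : Ker 1 β β C2) (hm0 : ∀ z, |m z| ≤ m0) (μ ν : Measure E3)
    [IsFiniteMeasure μ] [IsFiniteMeasure ν] :
    |_root_.modFull (fun p => PP m α β p.1 p.2) μ ν| ≤ m0 / 2 *
      (_root_.modFull (fun p => PP 1 α α p.1 p.2) μ ν
        + _root_.modFull (fun p => PP 1 β β p.1 p.2) μ ν) := by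
  obtain ⟨i, e⟩ := h.modFull μ ν
  obtain ⟨i1, e1⟩ := h1.modFull μ ν
  obtain ⟨i2, e2⟩ := h2.modFull μ ν
  rw [e, e1, e2, ← integral_add i1 i2, ← integral_const_mul, ← Real.norm_eq_abs]
  refine (norm_integral_le_integral_norm _).trans (integral_mono i.norm ((i1.add i2).const_mul _) ?_)
  intro z
  simp only [norm_mul, Real.norm_eq_abs, Pi.one_apply, one_mul]
  have hm := hm0 z
  have := abs_nonneg (m z)
  have a := two_mul_le_add_sq |HH α μ ν z| |HH β μ ν z|
  rw [sq_abs, sq_abs] at a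
  calc |m z| * (|HH α μ ν z| * |HH β μ ν z|) ≤ m0 * (|HH α μ ν z| * |HH β μ ν z|) := by gcongr
    _ ≤ _ := by nlinarith

lemma ker_trunc {η : ℝ} (hη : 0 < η) {m α β : E3 → ℝ} {m0 : ℝ}
    (hm : Measurable m) (hα : Measurable α) (hβ : Measurable β)
    (bm : ∀ z, |m z| ≤ m0) (bα : ∀ z, |α z| ≤ f0 z) (bβ : ∀ z, |β z| ≤ f0 z) :
    Ker m (trunc η α) (trunc η β) (m0 * (c1 / η)) :=
  ⟨hm, measurable_trunc η hα, measurable_trunc η hβ,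
    PP_trunc_integrable hη hm (measurable_trunc η hα) (measurable_trunc η hβ) bm
      (trunc_le η bα) (trunc_le η bβ),
    PP_trunc_norm_le hη hm (measurable_trunc η hα) (measurable_trunc η hβ) bm
      (trunc_le η bα) (trunc_le η bβ)⟩

lemma modFull_sum {ι : Type*} (s : Finset ι) {w : ι → E3 × E3 → ℝ} {C : ι → ℝ}
    (hw : ∀ i, Measurable (w i)) (hb : ∀ i p, |w i p| ≤ C i) (μ ν : Measure E3)
    [IsFiniteMeasure μ] [IsFiniteMeasure ν] :
    modFull (fun p => ∑ i ∈ s, w i p) μ ν = ∑ i ∈ s, modFull (w i) μ ν := by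
  unfold modFull
  rw [integral_finsetSum _ fun i _ => bdd_integrable (hw i) (hb i),
    integral_finsetSum _ fun i _ => bdd_integrable (hw i) (hb i),
    integral_finsetSum _ fun i _ => bdd_integrable (hw i) (hb i),
    integral_finsetSum _ fun i _ => bdd_integrable (hw i) (hb i)]
  rw [Finset.sum_add_distrib, Finset.sum_sub_distrib, Finset.sum_sub_distrib]


/-! ### Part 9: the measures -/

structure Sys (μ ν : Measure E3) (n M : ℝ) : Prop where
  pμ : IsProbabilityMeasure μ
  pν : IsProbabilityMeasure ν
  intμ : ∀ g : E3 → ℝ, Measurable g → Integrable g μ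
  diag : (μ.prod μ).real {p : E3 × E3 | p.1 = p.2} ≤ n⁻¹
  hν : ν ≤ ENNReal.ofReal M • (volume : Measure E3)
  hM : 0 ≤ M

def offD : Set (E3 × E3) := {p : E3 × E3 | p.1 ≠ p.2}
def onD : Set (E3 × E3) := {p : E3 × E3 | p.1 = p.2}

lemma meas_onD : MeasurableSet onD := measurableSet_eq_fun measurable_fst measurable_snd
lemma meas_offD : MeasurableSet offD := meas_onD.compl

lemma empMeas_prob {N : ℕ} (hN : 2 ≤ N) (X : Fin N → E3) : IsProbabilityMeasure (empMeas X) := by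
  constructor
  simp only [empMeas, Measure.smul_apply, Measure.finsetSum_apply, smul_eq_mul]
  simp
  exact ENNReal.inv_mul_cancel (by simp; omega) (by simp)

lemma empMeas_int {N : ℕ} (hN : 2 ≤ N) (X : Fin N → E3) (g : E3 → ℝ) (hg : Measurable g) :
    Integrable g (empMeas X) := by
  unfold empMeas
  refine Integrable.smul_measure ?_ (by simp; omega)
  rw [integrable_finsetSum_measure]
  intro i _
  exact integrable_dirac' hg.stronglyMeasurable (by simp)

lemma empMeas_singleton {N : ℕ} (X : Fin N → E3) (hX : Function.Injective X) (x : E3) :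
    empMeas X {x} ≤ (N : ℝ≥0∞)⁻¹ := by
  simp only [empMeas, Measure.smul_apply, Measure.finsetSum_apply, smul_eq_mul]
  refine (mul_le_mul_right ?_ _).trans (mul_one _).le
  simp only [Measure.dirac_apply' _ (measurableSet_singleton x), indicator_apply, mem_singleton_iff,
    Pi.one_apply]
  rw [Finset.sum_ite, Finset.sum_const_zero, add_zero, Finset.sum_const, nsmul_eq_mul, mul_one]
  have : (Finset.univ.filter fun j => X j = x).card ≤ 1 := by
    rw [Finset.card_le_one]
    intro a ha b hb
    simp only [Finset.mem_filter] at ha hb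
    exact hX (ha.2.trans hb.2.symm)
  exact_mod_cast this

lemma prod_onD (μ1 ν1 : Measure E3) [SFinite ν1] :
    (μ1.prod ν1) onD = ∫⁻ x, ν1 {x} ∂μ1 := by
  rw [Measure.prod_apply meas_onD]
  congr 1
  ext x
  congr 1
  ext y
  simp [onD, eq_comm]

lemma sys_mk {N : ℕ} (hN : 2 ≤ N) {ρ : E3 → ℝ} (hρ : Measurable ρ) (h0 : ∀ x, 0 ≤ ρ x)
    (h1 : (∫ x, ρ x) = 1) {M : ℝ} (hM : ∀ x, ρ x ≤ M) (X : Fin N → E3)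
    (hX : Function.Injective X) : Sys (empMeas X) (densMeas ρ) N M where
  pμ := empMeas_prob hN X
  pν := by
    constructor
    unfold densMeas
    rw [withDensity_apply _ MeasurableSet.univ, setLIntegral_univ]
    rw [← ofReal_integral_eq_lintegral_ofReal _ (Eventually.of_forall h0), h1]
    · simp
    · by_contra h
      rw [integral_undef h] at h1
      simp at h1
  intμ := empMeas_int hN X
  diag := by
    have := empMeas_prob hN X
    change (((empMeas X).prod (empMeas X)) onD).toReal ≤ _
    refine ENNReal.toReal_le_of_le_ofReal (by positivity) ?_
    rw [prod_onD]
    calc _ ≤ ∫⁻ x, (N : ℝ≥0∞)⁻¹ ∂(empMeas X) := lintegral_mono fun x => empMeas_singleton X hX x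
      _ = (N : ℝ≥0∞)⁻¹ := by simp
      _ = _ := by rw [ENNReal.ofReal_inv_of_pos (by positivity)]; simp
  hν := by
    unfold densMeas
    rw [← withDensity_const]
    exact withDensity_mono (Eventually.of_forall fun x => ENNReal.ofReal_le_ofReal (hM x))
  hM := (h0 0).trans (hM 0)

section
variable {μ ν : Measure E3} {n M : ℝ}

lemma Sys.atom (S : Sys μ ν n M) (x : E3) : ν {x} = 0 := by
  have := S.hν {x}
  simpa using this

lemma Sys.conv (S : Sys μ ν n M) {h : E3 → ℝ} (h0 : ∀ z, 0 ≤ h z) (hi : Integrable h) (x : E3) :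
    Integrable (fun y => h (x - y)) ν ∧ ∫ y, h (x - y) ∂ν ≤ M * ∫ z, h z := by
  have hi2 : Integrable (fun y => h (x - y)) (ENNReal.ofReal M • (volume : Measure E3)) :=
    (hi.comp_sub_left x).smul_measure ENNReal.ofReal_ne_top
  refine ⟨hi2.mono_measure S.hν, ?_⟩
  refine (integral_mono_measure S.hν (Eventually.of_forall fun y => h0 _) hi2).trans ?_
  rw [integral_smul_measure, integral_sub_left_eq_self, ENNReal.toReal_ofReal S.hM, smul_eq_mul]

lemma f0_split (z : E3) : f0 z ≤ (if ‖z‖ < 1 then f0 z else 0) + 1 := by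
  split_ifs with h
  · linarith
  · have h : 1 ≤ ‖z‖ := not_lt.1 h
    unfold f0
    rw [zero_add]
    exact inv_le_one_of_one_le₀ (one_le_pow₀ h)

lemma Sys.f0conv (S : Sys μ ν n M) (x : E3) :
    Integrable (fun y => f0 (x - y)) ν ∧ ∫ y, f0 (x - y) ∂ν ≤ 1 + M * c1 := by
  have := S.pν
  have hb := ball_f0 one_pos
  have hc := S.conv (h := fun z => if ‖z‖ < 1 then f0 z else 0)
    (fun z => by split_ifs; exacts [f0_nonneg z, le_rfl]) hb.1 x
  rw [hb.2, mul_one] at hc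
  have hi : Integrable (fun y => (if ‖x - y‖ < 1 then f0 (x - y) else 0) + 1) ν :=
    hc.1.add (integrable_const 1)
  have hi0 : Integrable (fun y => f0 (x - y)) ν := by
    refine hi.mono' (measurable_f0.comp (measurable_id.const_sub x)).aestronglyMeasurable
      (Eventually.of_forall fun y => ?_)
    rw [Real.norm_of_nonneg (f0_nonneg _)]
    exact f0_split _
  refine ⟨hi0, (integral_mono hi0 hi fun y => f0_split _).trans ?_⟩
  rw [integral_add hc.1 (integrable_const 1)]
  simp
  linarith [hc.2]

def f2 (p : E3 × E3) : ℝ := f0 (p.1 - p.2)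

lemma f2_nonneg (p : E3 × E3) : 0 ≤ f2 p := f0_nonneg _

lemma measurable_f2 : Measurable f2 := measurable_f0.comp (measurable_fst.sub measurable_snd)

/-- integrating a convolution kernel against `μ1 × ν` -/
lemma Sys.prod_conv (S : Sys μ ν n M) (μ1 : Measure E3) [IsProbabilityMeasure μ1]
    {h : E3 → ℝ} {C : ℝ} (hm : Measurable h) (h0 : ∀ z, 0 ≤ h z)
    (hc : ∀ x, Integrable (fun y => h (x - y)) ν ∧ ∫ y, h (x - y) ∂ν ≤ C) :
    Integrable (fun p : E3 × E3 => h (p.1 - p.2)) (μ1.prod ν) ∧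
      ∫ p : E3 × E3, h (p.1 - p.2) ∂(μ1.prod ν) ≤ C := by
  have := S.pν
  have hm2 : Measurable (fun p : E3 × E3 => h (p.1 - p.2)) :=
    hm.comp (measurable_fst.sub measurable_snd)
  have hI : Integrable (fun x => ∫ y, h (x - y) ∂ν) μ1 := by
    refine Integrable.mono' (integrable_const C)
      hm2.stronglyMeasurable.integral_prod_right.aestronglyMeasurable
      (Eventually.of_forall fun x => ?_)
    rw [Real.norm_of_nonneg (integral_nonneg fun _ => h0 _)]
    exact (hc x).2
  have I : Integrable (fun p : E3 × E3 => h (p.1 - p.2)) (μ1.prod ν) := by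
    rw [integrable_prod_iff hm2.aestronglyMeasurable]
    refine ⟨Eventually.of_forall fun x => (hc x).1, ?_⟩
    simpa only [Real.norm_of_nonneg (h0 _)] using hI
  refine ⟨I, ?_⟩
  rw [integral_prod _ I]
  refine (integral_mono hI (integrable_const C) fun x => (hc x).2).trans ?_
  simp

lemma Sys.prod_conv' (S : Sys μ ν n M) (μ1 : Measure E3) [IsProbabilityMeasure μ1]
    {h : E3 → ℝ} {C : ℝ} (hm : Measurable h) (h0 : ∀ z, 0 ≤ h z) (hs : ∀ z, h (-z) = h z)
    (hc : ∀ x, Integrable (fun y => h (x - y)) ν ∧ ∫ y, h (x - y) ∂ν ≤ C) :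
    Integrable (fun p : E3 × E3 => h (p.1 - p.2)) (ν.prod μ1) ∧
      ∫ p : E3 × E3, h (p.1 - p.2) ∂(ν.prod μ1) ≤ C := by
  have := S.pν
  have k := S.prod_conv μ1 hm h0 hc
  have e : (fun p : E3 × E3 => h (p.1 - p.2)) = (fun p : E3 × E3 => h (p.1 - p.2)) ∘ Prod.swap := by
    ext p
    simp only [Function.comp, Prod.fst_swap, Prod.snd_swap]
    rw [← hs, neg_sub]
  constructor
  · rw [e]; exact k.1.swap
  · refine le_trans (le_of_eq ?_) k.2
    rw [← integral_prod_swap]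
    refine integral_congr_ae (Eventually.of_forall fun p => ?_)
    exact (congrFun e p).symm

lemma Sys.null1 (S : Sys μ ν n M) (μ1 : Measure E3) : (μ1.prod ν) onD = 0 := by
  have := S.pν
  rw [prod_onD]; simp [S.atom]

lemma Sys.null2 (S : Sys μ ν n M) (μ1 : Measure E3) [SFinite μ1] : (ν.prod μ1) onD = 0 := by
  have := S.pν
  rw [← Measure.prod_swap, Measure.map_apply measurable_swap meas_onD]
  rw [← S.null1 μ1]
  congr 1
  ext p
  simp [onD, eq_comm]

lemma restrict_offD {m : Measure (E3 × E3)} (h : m onD = 0) : m.restrict offD = m := by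
  rw [Measure.restrict_eq_self_of_ae_mem]
  rw [ae_iff]
  convert h using 2
  ext p
  simp [offD, onD]

lemma offDiag_eq1 (S : Sys μ ν n M) (μ1 : Measure E3) (w : E3 × E3 → ℝ) :
    offDiagInt w μ1 ν = ∫ p, w p ∂(μ1.prod ν) := by
  unfold offDiagInt
  change ∫ p in offD, w p ∂_ = _
  rw [restrict_offD (S.null1 μ1)]

lemma offDiag_eq2 (S : Sys μ ν n M) (μ1 : Measure E3) [SFinite μ1] (w : E3 × E3 → ℝ) :
    offDiagInt w ν μ1 = ∫ p, w p ∂(ν.prod μ1) := by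
  unfold offDiagInt
  change ∫ p in offD, w p ∂_ = _
  rw [restrict_offD (S.null2 μ1)]

/-- `modDouble` versus `modFull` -/
lemma Sys.mod_diff (S : Sys μ ν n M) {w : E3 × E3 → ℝ} {C : ℝ} (hw : Measurable w)
    (hb : ∀ p, |w p| ≤ C) : |modDouble w μ ν - modFull w μ ν| ≤ C * n⁻¹ := by
  have := S.pμ
  have := S.pν
  have hC : 0 ≤ C := (abs_nonneg _).trans (hb 0)
  have e := integral_add_compl (μ := μ.prod μ) meas_onD (bdd_integrable hw hb)
  have e2 : offDiagInt w μ μ = ∫ p in onDᶜ, w p ∂(μ.prod μ) := rfl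
  unfold modDouble modFull
  rw [offDiag_eq1 S, offDiag_eq1 S, offDiag_eq2 S, ← e, e2]
  have e3 : ∀ a b c d f : ℝ, (a - b - c + d) - (f + a - b - c + d) = - f := by intros; ring
  rw [e3, abs_neg, ← Real.norm_eq_abs]
  refine (norm_setIntegral_le_of_norm_le_const (measure_lt_top _ _) fun p _ => hb p).trans ?_
  exact mul_le_mul_of_nonneg_left S.diag hC

/-- admissible kernels -/
def Adm (w : E3 × E3 → ℝ) : Prop := Measurable w ∧ ∃ C, ∀ p : E3 × E3, p.1 ≠ p.2 → |w p| ≤ C * (1 + f2 p)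

lemma Sys.f2_int (S : Sys μ ν n M) :
    Integrable f2 (μ.prod μ) ∧ Integrable f2 (μ.prod ν) ∧ Integrable f2 (ν.prod μ) ∧
      Integrable f2 (ν.prod ν) := by
  have := S.pμ
  have := S.pν
  refine ⟨?_, (S.prod_conv μ measurable_f0 f0_nonneg S.f0conv).1,
    (S.prod_conv' μ measurable_f0 f0_nonneg f0_neg S.f0conv).1,
    (S.prod_conv ν measurable_f0 f0_nonneg S.f0conv).1⟩
  rw [integrable_prod_iff measurable_f2.aestronglyMeasurable]
  refine ⟨Eventually.of_forall fun x => S.intμ _ ?_, S.intμ _ ?_⟩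
  · exact measurable_f2.comp measurable_prodMk_left
  · exact measurable_f2.stronglyMeasurable.norm.integral_prod_right.measurable

lemma Adm.intOn {w : E3 × E3 → ℝ} (hw : Adm w) {m : Measure (E3 × E3)} [IsFiniteMeasure m]
    (h : Integrable f2 m) : IntegrableOn w offD m := by
  obtain ⟨hm, C, hC⟩ := hw
  have : Integrable (fun p => C * (1 + f2 p)) m := ((integrable_const 1).add h).const_mul C
  refine Integrable.mono' this.integrableOn hm.aestronglyMeasurable ?_
  exact (ae_restrict_iff' meas_offD).2 (Eventually.of_forall fun p hp => hC p hp)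

lemma Adm.const_mul {w : E3 × E3 → ℝ} (hw : Adm w) (c : ℝ) : Adm (fun p => c * w p) := by
  obtain ⟨hm, C, hC⟩ := hw
  refine ⟨hm.const_mul c, |c| * C, fun p hp => ?_⟩
  rw [abs_mul, mul_assoc]
  exact mul_le_mul_of_nonneg_left (hC p hp) (abs_nonneg c)

lemma Adm.sub {w w' : E3 × E3 → ℝ} (hw : Adm w) (hw' : Adm w') : Adm (fun p => w p - w' p) := by
  obtain ⟨hm, C, hC⟩ := hw
  obtain ⟨hm', C', hC'⟩ := hw'
  refine ⟨hm.sub hm', C + C', fun p hp => ?_⟩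
  have := abs_sub (w p) (w' p)
  rw [add_mul]
  linarith [hC p hp, hC' p hp]

lemma adm_bdd {w : E3 × E3 → ℝ} {C : ℝ} (hm : Measurable w) (hb : ∀ p, |w p| ≤ C) : Adm w := by
  refine ⟨hm, C, fun p _ => (hb p).trans ?_⟩
  have := f2_nonneg p
  have := (abs_nonneg _).trans (hb p)
  nlinarith

lemma modDouble_congr {w w' : E3 × E3 → ℝ} (h : ∀ p : E3 × E3, p.1 ≠ p.2 → w p = w' p)
    (μ ν : Measure E3) : modDouble w μ ν = modDouble w' μ ν := by
  have : ∀ μ ν, offDiagInt w μ ν = offDiagInt w' μ ν := fun μ ν =>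
    setIntegral_congr_fun meas_offD fun p hp => h p hp
  unfold modDouble
  rw [this, this, this, this]

lemma modDouble_mul (c : ℝ) (w : E3 × E3 → ℝ) (μ ν : Measure E3) :
    modDouble (fun p => c * w p) μ ν = c * modDouble w μ ν := by
  unfold modDouble offDiagInt
  simp only [integral_const_mul]
  ring

lemma Sys.modDouble_sub (S : Sys μ ν n M) {w w' : E3 × E3 → ℝ} (hw : Adm w) (hw' : Adm w') :
    modDouble (fun p => w p - w' p) μ ν = modDouble w μ ν - modDouble w' μ ν := by
  have := S.pμ
  have := S.pν
  obtain ⟨i1, i2, i3, i4⟩ := S.f2_int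
  have e : ∀ {μ ν : Measure E3} [IsFiniteMeasure (μ.prod ν)], Integrable f2 (μ.prod ν) →
      offDiagInt (fun p => w p - w' p) μ ν = offDiagInt w μ ν - offDiagInt w' μ ν := by
    intro μ ν _ h
    exact integral_sub (hw.intOn h) (hw'.intOn h)
  unfold modDouble
  rw [e i1, e i2, e i3, e i4]
  ring

end


/-! ### Part 10: explicit lower bound on the energy -/

def gs (b : ℝ) (z : E3) : ℝ := rexp (-(2 * b) * ‖z‖ ^ 2)

lemma gs_int {b : ℝ} (hb : 0 < b) : Integrable (fun z : E3 => rexp (-b * ‖z‖ ^ 2)) := by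
  refine radial_integrable (f := fun r => rexp (-b * r ^ 2)) ?_
  have := integrableOn_rpow_mul_exp_neg_mul_sq hb (s := 2) (by norm_num)
  simpa using this

lemma gs_mul (b : ℝ) (x y z : E3) : gs b (z - x) * gs b (z - y)
    = rexp (-b * ‖x - y‖ ^ 2) * rexp (-(4 * b) * ‖z - (2⁻¹ : ℝ) • (x + y)‖ ^ 2) := by
  unfold gs
  rw [← Real.exp_add, ← Real.exp_add]
  congr 1
  have h := parallelogram_law_with_norm ℝ (z - x) (z - y)
  have e1 : (z - x) + (z - y) = (2 : ℝ) • (z - (2⁻¹ : ℝ) • (x + y)) := by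
    rw [smul_sub, smul_smul]; norm_num; rw [two_smul]; abel
  have e2 : (z - x) - (z - y) = -(x - y) := by abel
  rw [e1, e2, norm_neg, norm_smul, Real.norm_of_nonneg (by norm_num : (0:ℝ) ≤ 2)] at h
  linear_combination b * h

lemma gs_ker {b : ℝ} (hb : 0 < b) : Ker 1 (gs b) (gs b) (∫ z : E3, rexp (-(4 * b) * ‖z‖ ^ 2)) := by
  have hmeas : Measurable (gs b) := by unfold gs; fun_prop
  have hi := gs_int (b := 4 * b) (by positivity)
  have hI : ∀ x y : E3, Integrable (fun z => rexp (-b * ‖x - y‖ ^ 2) *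
      rexp (-(4 * b) * ‖z - (2⁻¹ : ℝ) • (x + y)‖ ^ 2)) := fun x y =>
    (hi.comp_sub_right _).const_mul _
  refine ⟨measurable_one, hmeas, hmeas, fun x y => ?_, fun x y => ?_⟩
  · simpa only [Pi.one_apply, one_mul, gs_mul] using hI x y
  · simp only [Pi.one_apply, one_mul, gs_mul]
    rw [← integral_sub_right_eq_self (fun z : E3 => rexp (-(4 * b) * ‖z‖ ^ 2)) ((2⁻¹ : ℝ) • (x + y))]
    refine integral_mono (hI x y).norm (hi.comp_sub_right _) fun z => ?_
    dsimp only
    rw [Real.norm_of_nonneg (by positivity)]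
    refine mul_le_of_le_one_left (by positivity) (Real.exp_le_one_iff.2 ?_)
    have := sq_nonneg ‖x - y‖
    nlinarith

lemma gs_pos {b : ℝ} (hb : 0 < b) : 0 < ∫ z : E3, rexp (-b * ‖z‖ ^ 2) := by
  rw [GaussianFourier.integral_rexp_neg_mul_sq_norm hb]; positivity

lemma gs_PP (b : ℝ) (x y : E3) : PP 1 (gs b) (gs b) x y
    = (∫ z : E3, rexp (-(4 * b) * ‖z‖ ^ 2)) * rexp (-b * ‖x - y‖ ^ 2) := by
  unfold PP
  simp only [Pi.one_apply, one_mul, gs_mul]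
  rw [integral_const_mul,
    integral_sub_right_eq_self (fun z : E3 => rexp (-(4 * b) * ‖z‖ ^ 2)) ((2⁻¹ : ℝ) • (x + y)), mul_comm]

lemma modFull_mul (c : ℝ) (w : E3 × E3 → ℝ) (μ ν : Measure E3) :
    modFull (fun p => c * w p) μ ν = c * modFull w μ ν := by
  unfold modFull
  simp only [integral_const_mul]
  ring

lemma gauss_nonneg {b : ℝ} (hb : 0 < b) (μ ν : Measure E3) [IsFiniteMeasure μ] [IsFiniteMeasure ν] :
    0 ≤ modFull (fun p => rexp (-b * ‖p.1 - p.2‖ ^ 2)) μ ν := by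
  have h := (gs_ker hb).sq_nonneg μ ν
  simp only [gs_PP] at h
  rw [modFull_mul] at h
  exact nonneg_of_mul_nonneg_right h (gs_pos (by positivity))

/-- low frequency part -/
def Klow (T : ℝ) (p : E3 × E3) : ℝ := ∫ τ in Ioc 0 T, rexp (-(τ ^ 2) * ‖p.1 - p.2‖ ^ 2)

lemma gexp_le (τ r : ℝ) : rexp (-(τ ^ 2) * r ^ 2) ≤ 1 := by
  refine Real.exp_le_one_iff.2 ?_
  nlinarith [mul_nonneg (sq_nonneg τ) (sq_nonneg r)]

lemma gexp_meas : Measurable (fun q : (E3 × E3) × ℝ => rexp (-(q.2 ^ 2) * ‖q.1.1 - q.1.2‖ ^ 2)) := by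
  fun_prop

lemma Klow_meas (T : ℝ) : Measurable (Klow T) :=
  gexp_meas.stronglyMeasurable.integral_prod_right.measurable

lemma Klow_le {T : ℝ} (hT : 0 < T) (p : E3 × E3) : |Klow T p| ≤ T := by
  unfold Klow
  rw [← Real.norm_eq_abs]
  have := norm_setIntegral_le_of_norm_le_const (μ := volume) (s := Ioc 0 T) (C := 1)
    (f := fun τ : ℝ => rexp (-(τ ^ 2) * ‖p.1 - p.2‖ ^ 2)) (by simp) (fun τ _ => by
      rw [Real.norm_of_nonneg (by positivity)]; exact gexp_le _ _)
  simpa [hT.le] using this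

lemma Klow_fubini (T : ℝ) (m : Measure (E3 × E3)) [IsFiniteMeasure m] :
    Integrable (fun τ => ∫ p, rexp (-(τ ^ 2) * ‖p.1 - p.2‖ ^ 2) ∂m) (volume.restrict (Ioc 0 T)) ∧
    ∫ p, Klow T p ∂m = ∫ τ in Ioc 0 T, ∫ p, rexp (-(τ ^ 2) * ‖p.1 - p.2‖ ^ 2) ∂m := by
  have hI : Integrable (fun q : (E3 × E3) × ℝ => rexp (-(q.2 ^ 2) * ‖q.1.1 - q.1.2‖ ^ 2))
      (m.prod (volume.restrict (Ioc 0 T))) := by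
    refine Integrable.mono' (integrable_const 1) gexp_meas.aestronglyMeasurable
      (Eventually.of_forall fun q => ?_)
    rw [Real.norm_of_nonneg (by positivity)]; exact gexp_le _ _
  exact ⟨hI.integral_prod_right, integral_integral_swap hI⟩

lemma Klow_nonneg (T : ℝ) (μ ν : Measure E3) [IsFiniteMeasure μ] [IsFiniteMeasure ν] :
    0 ≤ modFull (Klow T) μ ν := by
  obtain ⟨i1, e1⟩ := Klow_fubini T (μ.prod μ)
  obtain ⟨i2, e2⟩ := Klow_fubini T (μ.prod ν)
  obtain ⟨i3, e3⟩ := Klow_fubini T (ν.prod μ)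
  obtain ⟨i4, e4⟩ := Klow_fubini T (ν.prod ν)
  unfold modFull
  rw [e1, e2, e3, e4, ← int4 i1 i2 i3 i4]
  refine setIntegral_nonneg measurableSet_Ioc fun τ hτ => ?_
  exact gauss_nonneg (pow_pos hτ.1 2) μ ν

lemma gexp_int {r : ℝ} (hr : 0 < r) : Integrable (fun τ : ℝ => rexp (-(τ ^ 2) * r ^ 2)) := by
  have := integrable_exp_neg_mul_sq (b := r ^ 2) (by positivity)
  refine this.congr (Eventually.of_forall fun τ => ?_)
  dsimp only; congr 1; ring

lemma gexp_Ioi {r : ℝ} (hr : 0 < r) : ∫ τ in Ioi (0:ℝ), rexp (-(τ ^ 2) * r ^ 2) = √π / 2 * r⁻¹ := by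
  have := integral_gaussian_Ioi (r ^ 2)
  rw [Real.sqrt_div pi_pos.le, Real.sqrt_sq hr.le] at this
  have e : (fun τ : ℝ => rexp (-(τ ^ 2) * r ^ 2)) = fun τ => rexp (-(r ^ 2) * τ ^ 2) := by
    ext τ; congr 1; ring
  rw [e, this]; ring

lemma high_bd {T r : ℝ} (hT : 0 < T) (hr : 0 < r) :
    0 ≤ √π / 2 * r⁻¹ - ∫ τ in Ioc 0 T, rexp (-(τ ^ 2) * r ^ 2) ∧
    √π / 2 * r⁻¹ - ∫ τ in Ioc 0 T, rexp (-(τ ^ 2) * r ^ 2) ≤ √π / 2 * (r⁻¹ * rexp (-(T ^ 2) * r ^ 2)) := by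
  have hi := gexp_int hr
  have h1 : √π / 2 * r⁻¹ - ∫ τ in Ioc 0 T, rexp (-(τ ^ 2) * r ^ 2)
      = ∫ τ in Ioi T, rexp (-(τ ^ 2) * r ^ 2) := by
    rw [← gexp_Ioi hr, ← Ioc_union_Ioi_eq_Ioi hT.le, setIntegral_union
      (Ioc_disjoint_Ioi le_rfl) measurableSet_Ioi hi.integrableOn hi.integrableOn]
    ring
  rw [h1]
  refine ⟨integral_nonneg fun τ => by positivity, ?_⟩
  have h2 := (measurePreserving_add_right (volume : Measure ℝ) T).setIntegral_preimage_emb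
    (measurableEmbedding_addRight T) (fun τ => rexp (-(τ ^ 2) * r ^ 2)) (Ioi T)
  rw [← h2]
  have h3 : Set.preimage (fun x : ℝ => x + T) (Ioi T) = Ioi 0 := by ext x; simp
  rw [h3, ← mul_assoc, ← gexp_Ioi hr, ← integral_mul_const]
  refine setIntegral_mono_on (hi.comp_add_right T).integrableOn (hi.mul_const _).integrableOn
    measurableSet_Ioi fun s hs => ?_
  rw [← Real.exp_add]
  refine Real.exp_le_exp.2 ?_
  have hs : 0 < s := hs
  have : 0 ≤ s * T * r ^ 2 := by positivity
  nlinarith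

def hh (T : ℝ) (z : E3) : ℝ := √π / 2 * (‖z‖⁻¹ * rexp (-(T ^ 2) * ‖z‖ ^ 2))

lemma c1_eq : c1 = 4 * π := by
  unfold c1 Measure.real
  rw [EuclideanSpace.volume_ball_fin_three]
  simp [ENNReal.toReal_ofReal (by positivity : 0 ≤ π * 4 / 3)]
  ring

lemma int_r_exp {b : ℝ} (hb : 0 < b) : ∫ y in Ioi (0:ℝ), y * rexp (-b * y ^ 2) = (2 * b)⁻¹ := by
  have h := integral_mul_cexp_neg_mul_sq (b := (b : ℂ)) (by simpa using hb)
  rw [← Complex.ofReal_inj]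
  push_cast
  rw [← h, ← integral_complex_ofReal]
  push_cast
  rfl

lemma hh_int {T : ℝ} (hT : 0 < T) : Integrable (hh T) ∧ ∫ z, hh T z = √π * π / T ^ 2 := by
  have key : ∀ y ∈ Ioi (0:ℝ), y ^ 2 * (√π / 2 * (y⁻¹ * rexp (-(T ^ 2) * y ^ 2)))
      = √π / 2 * (y * rexp (-(T ^ 2) * y ^ 2)) := by
    intro y hy
    have : y ≠ 0 := (ne_of_gt hy)
    field_simp
  constructor
  · refine radial_integrable (f := fun y => √π / 2 * (y⁻¹ * rexp (-(T ^ 2) * y ^ 2))) ?_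
    rw [integrableOn_congr_fun key measurableSet_Ioi]
    exact ((integrable_mul_exp_neg_mul_sq (pow_pos hT 2)).const_mul _).integrableOn
  · refine (radial_integral (fun y => √π / 2 * (y⁻¹ * rexp (-(T ^ 2) * y ^ 2)))).trans ?_
    rw [setIntegral_congr_fun measurableSet_Ioi key, integral_const_mul, int_r_exp (pow_pos hT 2), c1_eq]
    field_simp
    ring

lemma inv_adm_bd (p : E3 × E3) : ‖p.1 - p.2‖⁻¹ ≤ 1 + f2 p := by
  unfold f2 f0
  rw [← inv_pow]
  nlinarith [sq_nonneg (‖p.1 - p.2‖⁻¹ - 1), sq_nonneg (‖p.1 - p.2‖⁻¹)]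

lemma inv_adm : Adm (fun p => ‖p.1 - p.2‖⁻¹) := by
  refine ⟨by fun_prop, 1, fun p _ => ?_⟩
  rw [abs_of_nonneg (by positivity), one_mul]
  exact inv_adm_bd p

lemma V_eq (z : E3) : V z = (4 * π)⁻¹ * ‖z‖⁻¹ := by unfold V; rw [mul_inv]

lemma Sys.V_mod {μ ν : Measure E3} : modDouble (fun p => ‖p.1 - p.2‖⁻¹) μ ν
    = 4 * π * modDouble (fun p => V (p.1 - p.2)) μ ν := by
  simp only [V_eq]
  rw [modDouble_mul]
  field_simp

lemma Sys.lower {μ ν : Measure E3} {n M T : ℝ} (S : Sys μ ν n M) (hT : 0 < T) :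
    -(T * n⁻¹) - M * (2 * (√π * π / T ^ 2)) ≤
      √π / 2 * (4 * π * modDouble (fun p => V (p.1 - p.2)) μ ν) := by
  have := S.pμ
  have := S.pν
  have hd := S.mod_diff (Klow_meas T) (Klow_le hT)
  have h0 := Klow_nonneg T μ ν
  have aK : Adm (Klow T) := adm_bdd (Klow_meas T) (Klow_le hT)
  have aV := inv_adm.const_mul (√π / 2)
  have aG := aV.sub aK
  rw [← V_mod, ← modDouble_mul]
  have hsub := S.modDouble_sub aV aK
  obtain ⟨hi, he⟩ := hh_int hT
  have hh0 : ∀ z, 0 ≤ hh T z := fun z => by unfold hh; positivity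
  have hhm : Measurable (hh T) := by unfold hh; fun_prop
  have hc := fun x => S.conv hh0 hi x
  have hs : ∀ z, hh T (-z) = hh T z := fun z => by unfold hh; rw [norm_neg]
  have k1 := S.prod_conv μ hhm hh0 hc
  have k2 := S.prod_conv' μ hhm hh0 hs hc
  have hb : ∀ p ∈ offD, 0 ≤ √π / 2 * ‖p.1 - p.2‖⁻¹ - Klow T p ∧
      √π / 2 * ‖p.1 - p.2‖⁻¹ - Klow T p ≤ hh T (p.1 - p.2) := fun p hp =>
    high_bd hT (norm_pos_iff.2 (sub_ne_zero.2 hp))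
  obtain ⟨i1, i2, i3, i4⟩ := S.f2_int
  have b1 : 0 ≤ offDiagInt (fun p => √π / 2 * ‖p.1 - p.2‖⁻¹ - Klow T p) μ μ :=
    setIntegral_nonneg meas_offD fun p hp => (hb p hp).1
  have b4 : 0 ≤ offDiagInt (fun p => √π / 2 * ‖p.1 - p.2‖⁻¹ - Klow T p) ν ν :=
    setIntegral_nonneg meas_offD fun p hp => (hb p hp).1
  have b2 : offDiagInt (fun p => √π / 2 * ‖p.1 - p.2‖⁻¹ - Klow T p) μ ν ≤ M * (√π * π / T ^ 2) := by
    rw [← he]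
    refine le_trans ?_ k1.2
    rw [← offDiag_eq1 S μ]
    exact setIntegral_mono_on (aG.intOn i2) k1.1.integrableOn meas_offD fun p hp => (hb p hp).2
  have b3 : offDiagInt (fun p => √π / 2 * ‖p.1 - p.2‖⁻¹ - Klow T p) ν μ ≤ M * (√π * π / T ^ 2) := by
    rw [← he]
    refine le_trans ?_ k2.2
    rw [← offDiag_eq2 S μ]
    exact setIntegral_mono_on (aG.intOn i3) k2.1.integrableOn meas_offD fun p hp => (hb p hp).2
  have hG : -(M * (2 * (√π * π / T ^ 2))) ≤
      modDouble (fun p => √π / 2 * ‖p.1 - p.2‖⁻¹ - Klow T p) μ ν := by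
    unfold modDouble
    linarith
  have := (abs_le.1 hd).1
  linarith

lemma Sys.lower' {μ ν : Measure E3} {n M η : ℝ} (S : Sys μ ν n M) (hη : 0 < η) (h1 : η ≤ 1)
    (h3 : η ^ 3 = n⁻¹) :
    -(1 / 2 * ((1 + M) * η)) ≤ modDouble (fun p => V (p.1 - p.2)) μ ν := by
  have hT2 : √(2 / η) ^ 2 = 2 / η := Real.sq_sqrt (by positivity)
  have h := S.lower (T := √(2 / η)) (by positivity)
  have hT : √(2 / η) ≤ 2 / η := by
    have : 1 ≤ 2 / η := by rw [le_div_iff₀ hη]; linarith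
    exact Real.sqrt_le_iff.2 ⟨by positivity, by nlinarith⟩
  rw [hT2, ← h3] at h
  set F := modDouble (fun p => V (p.1 - p.2)) μ ν
  have hM := S.hM
  have hp := Real.pi_gt_three
  have hs : 1 ≤ √π := Real.one_le_sqrt.2 (by linarith)
  have e1 : √(2 / η) * η ^ 3 ≤ √π * π * η := by
    calc _ ≤ 2 / η * η ^ 3 := by gcongr
      _ = 2 * η ^ 2 := by field_simp
      _ ≤ 2 * η := by nlinarith
      _ ≤ √π * π * η := by
        have : 2 ≤ √π * π := by nlinarith
        gcongr
  have e2 : M * (2 * (√π * π / (2 / η))) = √π * π * (M * η) := by field_simp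
  rw [e2] at h
  have hpos : 0 < √π * π := by positivity
  have : √π * π * (-(1 / 2 * ((1 + M) * η))) ≤ √π * π * F := by nlinarith
  exact le_of_mul_le_mul_left this hpos


/-! ### Part 11: assembly -/

def Kt (η : ℝ) (p : E3 × E3) : ℝ := PP 1 (fT η) (fT η) p.1 p.2

def Gr (η : ℝ) (p : E3 × E3) : ℝ := c3 * ‖p.1 - p.2‖⁻¹ - Kt η p

lemma abs_one_le (z : E3) : |(1 : E3 → ℝ) z| ≤ 1 := by simp

lemma abs_f0_le (z : E3) : |f0 z| ≤ f0 z := (abs_of_nonneg (f0_nonneg z)).le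

lemma Kt_ker {η : ℝ} (hη : 0 < η) : Ker 1 (fT η) (fT η) (1 * (c1 / η)) :=
  ker_trunc hη measurable_one measurable_f0 measurable_f0 abs_one_le abs_f0_le abs_f0_le

lemma Kt_adm {η : ℝ} (hη : 0 < η) : Adm (Kt η) :=
  adm_bdd (Kt_ker hη).measurable fun p => (Kt_ker hη).abs_le p.1 p.2

lemma Gr_adm {η : ℝ} (hη : 0 < η) : Adm (Gr η) := (inv_adm.const_mul c3).sub (Kt_adm hη)

lemma Gr_eq (η : ℝ) {p : E3 × E3} (hp : p.1 ≠ p.2) : Gr η p = Gk η p.1 p.2 := by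
  unfold Gr Gk Kt
  rw [Rk_eq hp, div_eq_mul_inv]

lemma Gr_nonneg {η : ℝ} (hη : 0 < η) {p : E3 × E3} (hp : p.1 ≠ p.2) : 0 ≤ Gr η p := by
  rw [Gr_eq η hp]; exact Gk_nonneg hη hp

section
variable {μ ν : Measure E3} {n M η : ℝ}

lemma Sys.Gr_bd (S : Sys μ ν n M) (hη : 0 < η) :
    0 ≤ offDiagInt (Gr η) μ μ ∧ 0 ≤ offDiagInt (Gr η) μ ν ∧ 0 ≤ offDiagInt (Gr η) ν μ ∧
    0 ≤ offDiagInt (Gr η) ν ν ∧ offDiagInt (Gr η) μ ν ≤ c2 * η * (1 + M * c1) ∧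
    offDiagInt (Gr η) ν μ ≤ c2 * η * (1 + M * c1) ∧ offDiagInt (Gr η) ν ν ≤ c2 * η * (1 + M * c1) := by
  have := S.pμ
  have := S.pν
  obtain ⟨i1, i2, i3, i4⟩ := S.f2_int
  have hn : ∀ μ1 ν1 : Measure E3, 0 ≤ offDiagInt (Gr η) μ1 ν1 := fun μ1 ν1 =>
    setIntegral_nonneg meas_offD fun p hp => Gr_nonneg hη hp
  have hc : 0 ≤ c2 * η := by have := c2_pos; positivity
  have hle : ∀ {μ1 ν1 : Measure E3} [IsProbabilityMeasure μ1] [IsProbabilityMeasure ν1],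
      Integrable f2 (μ1.prod ν1) → ∫ p, f2 p ∂(μ1.prod ν1) ≤ 1 + M * c1 →
      offDiagInt (Gr η) μ1 ν1 ≤ c2 * η * (1 + M * c1) := by
    intro μ1 ν1 _ _ hi hb
    calc offDiagInt (Gr η) μ1 ν1 ≤ ∫ p in offD, c2 * η * f2 p ∂(μ1.prod ν1) := by
          refine setIntegral_mono_on ((Gr_adm hη).intOn hi) (hi.const_mul _).integrableOn meas_offD
            fun p hp => ?_
          rw [Gr_eq η hp]
          exact Gk_le hη hp
      _ ≤ ∫ p, c2 * η * f2 p ∂(μ1.prod ν1) :=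
          setIntegral_le_integral (hi.const_mul _)
            (Eventually.of_forall fun p => mul_nonneg hc (f2_nonneg p))
      _ = c2 * η * ∫ p, f2 p ∂(μ1.prod ν1) := integral_const_mul _ _
      _ ≤ _ := mul_le_mul_of_nonneg_left hb hc
  exact ⟨hn _ _, hn _ _, hn _ _, hn _ _,
    hle i2 (S.prod_conv μ measurable_f0 f0_nonneg S.f0conv).2,
    hle i3 (S.prod_conv' μ measurable_f0 f0_nonneg f0_neg S.f0conv).2,
    hle i4 (S.prod_conv ν measurable_f0 f0_nonneg S.f0conv).2⟩

lemma Sys.comp (S : Sys μ ν n M) (hη : 0 < η) {w : E3 × E3 → ℝ} {k : ℝ} (hk : 0 ≤ k)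
    (hb : ∀ p : E3 × E3, p.1 ≠ p.2 → |w p| ≤ k * Gk η p.1 p.2) :
    |modDouble w μ ν| ≤ k * (offDiagInt (Gr η) μ μ + 3 * (c2 * η * (1 + M * c1))) := by
  have := S.pμ
  have := S.pν
  obtain ⟨i1, i2, i3, i4⟩ := S.f2_int
  obtain ⟨b1, b2, b3, b4, b5, b6, b7⟩ := S.Gr_bd hη
  have h : ∀ {μ1 ν1 : Measure E3} [IsProbabilityMeasure μ1] [IsProbabilityMeasure ν1],
      Integrable f2 (μ1.prod ν1) → |offDiagInt w μ1 ν1| ≤ k * offDiagInt (Gr η) μ1 ν1 := by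
    intro μ1 ν1 _ _ hi
    have hg : IntegrableOn (fun p => k * Gr η p) offD (μ1.prod ν1) :=
      ((Gr_adm hη).const_mul k).intOn hi
    have e : k * offDiagInt (Gr η) μ1 ν1 = ∫ p in offD, k * Gr η p ∂(μ1.prod ν1) :=
      (integral_const_mul _ _).symm
    rw [e, ← Real.norm_eq_abs]
    refine norm_integral_le_of_norm_le hg ?_
    refine (ae_restrict_iff' meas_offD).2 (Eventually.of_forall fun p hp => ?_)
    rw [Gr_eq η hp]
    exact hb p hp
  have h1 := abs_le.1 (h i1)
  have h2 := abs_le.1 (h i2)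
  have h3 := abs_le.1 (h i3)
  have h4 := abs_le.1 (h i4)
  have b5 := mul_le_mul_of_nonneg_left b5 hk
  have b6 := mul_le_mul_of_nonneg_left b6 hk
  have b7 := mul_le_mul_of_nonneg_left b7 hk
  unfold modDouble
  rw [abs_le, mul_add]
  constructor <;> linarith [h1.1, h1.2, h2.1, h2.2, h3.1, h3.2, h4.1, h4.2]

lemma Sys.Sg_le (S : Sys μ ν n M) (hη : 0 < η) :
    offDiagInt (Gr η) μ μ ≤ c3 * modDouble (fun p => ‖p.1 - p.2‖⁻¹) μ ν + c1 / η * n⁻¹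
      + 2 * (c2 * η * (1 + M * c1)) := by
  have := S.pμ
  have := S.pν
  obtain ⟨b1, b2, b3, b4, b5, b6, b7⟩ := S.Gr_bd hη
  have h1 := S.modDouble_sub (inv_adm.const_mul c3) (Kt_adm hη)
  have h2 := S.mod_diff (Kt_ker hη).measurable fun p => (Kt_ker hη).abs_le p.1 p.2
  have h3 := (Kt_ker hη).sq_nonneg μ ν
  have h4 : modDouble (Gr η) μ ν = c3 * modDouble (fun p => ‖p.1 - p.2‖⁻¹) μ ν - modDouble (Kt η) μ ν := by
    rw [← modDouble_mul, ← h1]; rfl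
  have h5 : modDouble (Gr η) μ ν = offDiagInt (Gr η) μ μ - offDiagInt (Gr η) μ ν
    - offDiagInt (Gr η) ν μ + offDiagInt (Gr η) ν ν := rfl
  have h6 : modDouble (Kt η) μ ν = modDouble (fun p => PP 1 (fT η) (fT η) p.1 p.2) μ ν := rfl
  have h7 := (abs_le.1 h2).1
  rw [one_mul] at h7
  linarith

def om (η : ℝ) (p : E3 × E3) : ℝ := ∑ j : Fin 3, PP 1 (trunc η (Af j)) (trunc η (Af j)) p.1 p.2

lemma om_ker (hη : 0 < η) (j : Fin 3) : Ker 1 (trunc η (Af j)) (trunc η (Af j)) (1 * (c1 / η)) :=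
  ker_trunc hη measurable_one (measurable_Af j) (measurable_Af j) abs_one_le (Af_le j) (Af_le j)

lemma om_meas (hη : 0 < η) : Measurable (om η) :=
  Finset.measurable_sum _ fun j _ => (om_ker hη j).measurable

lemma om_le (hη : 0 < η) (p : E3 × E3) : |om η p| ≤ 3 * (c1 / η) := by
  refine (Finset.abs_sum_le_sum_abs _ _).trans ?_
  refine (Finset.sum_le_sum fun j _ => (om_ker hη j).abs_le p.1 p.2).trans ?_
  simp

lemma Sys.om_mod (S : Sys μ ν n M) (hη : 0 < η) :
    modFull (om η) μ ν ≤ cq * modDouble (fun p => ‖p.1 - p.2‖⁻¹) μ ν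
      + 3 * (offDiagInt (Gr η) μ μ + 3 * (c2 * η * (1 + M * c1))) + 3 * (c1 / η * n⁻¹) := by
  have := S.pμ
  have := S.pν
  have h1 := S.modDouble_sub (inv_adm.const_mul cq) (adm_bdd (om_meas hη) (om_le hη))
  have h2 := (abs_le.1 (S.mod_diff (om_meas hη) (om_le hη))).1
  have h3 := S.comp hη (w := fun p => cq * ‖p.1 - p.2‖⁻¹ - om η p) (k := 3) (by norm_num) (by
    intro p hp
    have := V_identity hp
    rw [← div_eq_mul_inv, ← this]
    unfold om
    rw [← Finset.sum_sub_distrib]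
    refine (Finset.abs_sum_le_sum_abs _ _).trans ?_
    refine (Finset.sum_le_sum fun j _ => PP_diff_le hη measurable_one (measurable_Af j)
      (measurable_Af j) abs_one_le (Af_le j) (Af_le j) hp).trans ?_
    simp)
  rw [h1, modDouble_mul] at h3
  have := (abs_le.1 h3).1
  linarith

def kap (v : Fin 3 → E3 → ℝ) (η : ℝ) (p : E3 × E3) : ℝ :=
  ∑ i : Fin 3, ∑ j : Fin 3, PP (EE v i j) (trunc η (Af i)) (trunc η (Af j)) p.1 p.2

variable {v : Fin 3 → E3 → ℝ} {L : ℝ≥0}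

lemma kap_ker (hη : 0 < η) (hv : ∀ j, LipschitzWith L (v j)) (i j : Fin 3) :
    Ker (EE v i j) (trunc η (Af i)) (trunc η (Af j)) (5 * L * (c1 / η)) :=
  ker_trunc hη (measurable_EE hv i j) (measurable_Af i) (measurable_Af j) (EE_le hv i j)
    (Af_le i) (Af_le j)

lemma kap_meas (hη : 0 < η) (hv : ∀ j, LipschitzWith L (v j)) : Measurable (kap v η) :=
  Finset.measurable_sum _ fun i _ => Finset.measurable_sum _ fun j _ => (kap_ker hη hv i j).measurable

lemma kap_row (hη : 0 < η) (hv : ∀ j, LipschitzWith L (v j)) (i : Fin 3) (p : E3 × E3) :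
    |∑ j : Fin 3, PP (EE v i j) (trunc η (Af i)) (trunc η (Af j)) p.1 p.2| ≤ 15 * L * (c1 / η) := by
  refine (Finset.abs_sum_le_sum_abs _ _).trans ?_
  refine (Finset.sum_le_sum fun j _ => (kap_ker hη hv i j).abs_le p.1 p.2).trans ?_
  simp
  apply le_of_eq
  ring

lemma kap_le (hη : 0 < η) (hv : ∀ j, LipschitzWith L (v j)) (p : E3 × E3) :
    |kap v η p| ≤ 45 * L * (c1 / η) := by
  refine (Finset.abs_sum_le_sum_abs _ _).trans ?_
  refine (Finset.sum_le_sum fun i _ => kap_row hη hv i p).trans ?_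
  simp
  apply le_of_eq
  ring

lemma kap_mod (hη : 0 < η) (hv : ∀ j, LipschitzWith L (v j)) (μ ν : Measure E3)
    [IsFiniteMeasure μ] [IsFiniteMeasure ν] :
    |modFull (kap v η) μ ν| ≤ 15 * L * modFull (om η) μ ν := by
  have e1 : modFull (kap v η) μ ν = ∑ i : Fin 3, ∑ j : Fin 3,
      modFull (fun p => PP (EE v i j) (trunc η (Af i)) (trunc η (Af j)) p.1 p.2) μ ν := by
    unfold kap
    rw [modFull_sum Finset.univ
      (fun i => Finset.measurable_sum _ fun j _ => (kap_ker hη hv i j).measurable) (kap_row hη hv)]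
    refine Finset.sum_congr rfl fun i _ => ?_
    exact modFull_sum Finset.univ (fun j => (kap_ker hη hv i j).measurable)
      (fun j p => (kap_ker hη hv i j).abs_le p.1 p.2) μ ν
  have e2 : modFull (om η) μ ν = ∑ j : Fin 3,
      modFull (fun p => PP 1 (trunc η (Af j)) (trunc η (Af j)) p.1 p.2) μ ν :=
    modFull_sum Finset.univ (fun j => (om_ker hη j).measurable)
      (fun j p => (om_ker hη j).abs_le p.1 p.2) μ ν
  rw [e1, e2]
  refine (Finset.abs_sum_le_sum_abs _ _).trans ?_
  refine (Finset.sum_le_sum fun i _ => (Finset.abs_sum_le_sum_abs _ _).trans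
    (Finset.sum_le_sum fun j _ => (kap_ker hη hv i j).modFull_le (om_ker hη i) (om_ker hη j)
      (EE_le hv i j) μ ν)).trans ?_
  simp only [Fin.sum_univ_three]
  apply le_of_eq
  ring

def kk (u : E3 → E3) (p : E3 × E3) : ℝ := inner ℝ (u p.1 - u p.2) (p.1 - p.2) / ‖p.1 - p.2‖ ^ 3

lemma kk_adm {u : E3 → E3} (hu : LipschitzWith L u) : Adm (kk u) := by
  refine ⟨?_, L, fun p hp => ?_⟩
  · have := hu.continuous.measurable
    unfold kk
    fun_prop
  · have hr : 0 < ‖p.1 - p.2‖ := norm_pos_iff.2 (sub_ne_zero.2 hp)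
    have h1 := abs_real_inner_le_norm (u p.1 - u p.2) (p.1 - p.2)
    have h2 := hu.norm_sub_le p.1 p.2
    have hL : (0:ℝ) ≤ L := L.2
    unfold kk
    rw [abs_div, abs_of_pos (pow_pos hr 3)]
    have h3 := inv_adm_bd p
    calc _ ≤ (L * ‖p.1 - p.2‖ * ‖p.1 - p.2‖) / ‖p.1 - p.2‖ ^ 3 := by
          gcongr
          exact h1.trans (by gcongr)
      _ = L * ‖p.1 - p.2‖⁻¹ := by field_simp
      _ ≤ _ := by gcongr

lemma Sys.main (S : Sys μ ν n M) (hη : 0 < η) {u : E3 → E3} {B : ℝ} (hu : LipschitzWith L u)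
    (hB : ∀ x, ‖u x‖ ≤ B) :
    cq * |modDouble (kk u) μ ν| ≤ L * ((15 * cq + 90 * c3) * modDouble (fun p => ‖p.1 - p.2‖⁻¹) μ ν
      + 450 * (c2 * η * (1 + M * c1)) + 180 * (c1 / η * n⁻¹)) := by
  have := S.pμ
  have := S.pν
  have hL : (0:ℝ) ≤ L := L.2
  set v : Fin 3 → E3 → ℝ := fun j z => u z j with hvdef
  have hv : ∀ j, LipschitzWith L (v j) := by
    intro j
    refine LipschitzWith.of_dist_le_mul fun x y => ?_
    rw [Real.dist_eq]
    have h1 := abs_coord_le (u x - u y) j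
    have h2 := hu.dist_le_mul x y
    rw [dist_eq_norm (u x)] at h2
    exact h1.trans h2
  have hb : ∀ j z, |v j z| ≤ B := fun j z => (abs_coord_le _ j).trans (hB z)
  have h1 := S.modDouble_sub ((kk_adm hu).const_mul (-cq)) (adm_bdd (kap_meas hη hv) (kap_le hη hv))
  have h2 := abs_le.1 (S.mod_diff (kap_meas hη hv) (kap_le hη hv))
  have h3 := S.comp hη (w := fun p => -cq * kk u p - kap v η p) (k := 45 * L) (by positivity) (by
    intro p hp
    have e : kk u p = (∑ j, (v j p.1 - v j p.2) * (p.1 j - p.2 j)) / ‖p.1 - p.2‖ ^ 3 := by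
      unfold kk
      congr 1
      rw [PiLp.inner_apply]
      refine Finset.sum_congr rfl fun j _ => ?_
      simp [hvdef, mul_comm]
    rw [e, ← lemmaA_PP hv hb hp]
    unfold kap
    rw [← Finset.sum_sub_distrib]
    simp only [← Finset.sum_sub_distrib]
    refine (Finset.abs_sum_le_sum_abs _ _).trans ?_
    refine (Finset.sum_le_sum fun i _ => (Finset.abs_sum_le_sum_abs _ _).trans
      (Finset.sum_le_sum fun j _ => PP_diff_le hη (measurable_EE hv i j) (measurable_Af i)
      (measurable_Af j) (EE_le hv i j) (Af_le i) (Af_le j) hp)).trans ?_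
    simp
    apply le_of_eq
    ring)
  rw [h1, modDouble_mul] at h3
  have h3 := abs_le.1 h3
  have h4 := abs_le.1 (kap_mod hη hv μ ν)
  have h5 := mul_le_mul_of_nonneg_left (S.om_mod hη) hL
  have h6 := mul_le_mul_of_nonneg_left (S.Sg_le hη) hL
  rw [← abs_of_pos cq_pos, ← abs_mul, abs_of_pos cq_pos, abs_le]
  constructor <;> linarith [h2.1, h2.2, h3.1, h3.2, h4.1, h4.2]

end

lemma grad_kk (u : E3 → E3) (p : E3 × E3) :
    inner ℝ (u p.1 - u p.2) (gradV (p.1 - p.2)) = -(4 * π)⁻¹ * kk u p := by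
  unfold gradV kk
  rw [inner_smul_right, mul_inv]
  ring

lemma serfaty : ∃ C : ℝ, 2 < C ∧ ∀ (μ ν : Measure E3) (n M η : ℝ), Sys μ ν n M → 0 < η → η ≤ 1 →
    η ^ 3 = n⁻¹ → ∀ (u : E3 → E3) (L : ℝ≥0), LipschitzWith L u → ∀ B : ℝ, (∀ x, ‖u x‖ ≤ B) →
    |modDouble (fun p => inner ℝ (u p.1 - u p.2) (gradV (p.1 - p.2))) μ ν| ≤
      C * L * modDouble (fun p => V (p.1 - p.2)) μ ν + C * L * ((1 + M) * η) := by
  have hq := cq_pos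
  have h1 := c1_pos
  have h2 := c2_pos
  have h3 := c3_pos
  have hp := pi_pos
  set A := (15 * cq + 90 * c3) / cq with hA
  have hA0 : 0 < A := by positivity
  set P := (450 * (c2 * (1 + c1)) + 180 * c1) / (cq * (4 * π)) with hP
  have hP0 : 0 < P := by positivity
  refine ⟨A + 2 * P + 3, by linarith, ?_⟩
  intro μ ν n M η S hη hη1 hη3 u L hu B hB
  have hM := S.hM
  have hL : (0:ℝ) ≤ L := L.2
  have low := S.lower' hη hη1 hη3
  have main := S.main hη hu hB
  rw [Sys.V_mod] at main
  set F := modDouble (fun p => V (p.1 - p.2)) μ ν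
  have e : |modDouble (fun p => inner ℝ (u p.1 - u p.2) (gradV (p.1 - p.2))) μ ν|
      = (4 * π)⁻¹ * |modDouble (kk u) μ ν| := by
    simp only [grad_kk]
    rw [modDouble_mul, abs_mul, abs_neg, abs_of_pos (by positivity)]
  rw [e]
  have g1 : c2 * η * (1 + M * c1) ≤ c2 * (1 + c1) * ((1 + M) * η) := by
    have : 1 + M * c1 ≤ (1 + c1) * (1 + M) := by nlinarith
    calc _ ≤ c2 * η * ((1 + c1) * (1 + M)) := by gcongr
      _ = _ := by ring
  have g2 : c1 / η * n⁻¹ ≤ c1 * ((1 + M) * η) := by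
    rw [← hη3]
    have e : c1 / η * η ^ 3 = c1 * (η * η) := by field_simp
    rw [e]
    gcongr
    linarith
  have step : (4 * π)⁻¹ * |modDouble (kk u) μ ν| ≤ L * (A * F + P * ((1 + M) * η)) := by
    have k1 : cq * |modDouble (kk u) μ ν| ≤ L * ((15 * cq + 90 * c3) * (4 * π * F)
      + 450 * (c2 * (1 + c1) * ((1 + M) * η)) + 180 * (c1 * ((1 + M) * η))) := by
      refine main.trans ?_
      gcongr
    have k2 : L * ((15 * cq + 90 * c3) * (4 * π * F)
      + 450 * (c2 * (1 + c1) * ((1 + M) * η)) + 180 * (c1 * ((1 + M) * η)))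
      = cq * (4 * π) * (L * (A * F + P * ((1 + M) * η))) := by
      rw [hA, hP]; field_simp; ring
    rw [k2, mul_assoc] at k1
    rw [inv_mul_le_iff₀ (by positivity)]
    exact le_of_mul_le_mul_left k1 hq
  refine step.trans ?_
  set t := (1 + M) * η
  have ht : 0 ≤ t := by positivity
  have : A * F + P * t ≤ (A + 2 * P + 3) * F + (A + 2 * P + 3) * t := by nlinarith
  calc _ ≤ L * ((A + 2 * P + 3) * F + (A + 2 * P + 3) * t) := by gcongr
    _ = _ := by ring

end

/-- Serfaty's inequality (Coulomb case, `d = 3`), Proposition 2.3 in Duerinckx–Serfaty: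
here `L` is the Lipschitz constant of `u` (playing the role of `‖∇u‖_{L^∞}`),
`B` is a sup-norm bound on `u` and `M` a sup-norm bound on `ρ`, so that
`B + L` plays the role of `‖u‖_{W^{1,∞}}`. -/
theorem statement17 :
    ∃ C : ℝ, 2 < C ∧
      ∀ (N : ℕ), 2 ≤ N →
      ∀ ρ : E3 → ℝ, Measurable ρ → (∀ x, 0 ≤ ρ x) → (∫ x, ρ x) = 1 →
      ∀ M : ℝ, (∀ x, ρ x ≤ M) →
      ∀ (u : E3 → E3) (L : ℝ≥0), LipschitzWith L u →
      ∀ B : ℝ, (∀ x, ‖u x‖ ≤ B) →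
      ∀ X : Fin N → E3, Function.Injective X →
        |FN' N X ρ u|
          ≤ C * L * FN N X ρ
            + C * (1 + M) * (1 + B + L) * (N : ℝ) ^ ((5 : ℝ) / 3) := by
  obtain ⟨C, hC, h⟩ := serfaty
  refine ⟨C, hC, ?_⟩
  intro N hN ρ hρ h0 h1 M hM u L hu B hB X hX
  have S := sys_mk hN hρ h0 h1 hM X hX
  have hN0 : (0:ℝ) < N := by positivity
  have hN1 : (1:ℝ) ≤ N := by exact_mod_cast (by omega : 1 ≤ N)
  have hM0 := S.hM
  have hB0 : 0 ≤ B := (norm_nonneg _).trans (hB 0)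
  have hL : (0:ℝ) ≤ L := L.2
  have k := h _ _ _ M ((N : ℝ) ^ (-(1:ℝ) / 3)) S (by positivity)
    (Real.rpow_le_one_of_one_le_of_nonpos hN1 (by norm_num))
    (by
      rw [← Real.rpow_natCast, ← Real.rpow_mul hN0.le, ← Real.rpow_neg_one]
      norm_num) u L hu B hB
  have e : (N : ℝ) ^ 2 * (N : ℝ) ^ (-(1:ℝ) / 3) = (N : ℝ) ^ ((5:ℝ) / 3) := by
    rw [← Real.rpow_natCast, ← Real.rpow_add hN0]
    norm_num
  unfold FN' FN
  rw [abs_mul, abs_of_pos (by positivity : (0:ℝ) < (N:ℝ) ^ 2)]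
  refine (mul_le_mul_of_nonneg_left k (by positivity : (0:ℝ) ≤ (N:ℝ) ^ 2)).trans ?_
  rw [← e]
  have hle : C * (1 + M) * L * ((N : ℝ) ^ 2 * (N : ℝ) ^ (-(1:ℝ) / 3)) ≤
      C * (1 + M) * (1 + B + L) * ((N : ℝ) ^ 2 * (N : ℝ) ^ (-(1:ℝ) / 3)) := by
    gcongr
    linarith
  linarith
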